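/- Let f : A* → B* be a total function computed by a deterministic marble transducer and let k ≥ 0. Then f is computable by a k-marble transducer if and only if |f(w)| = O(|w|^{k+1}). -/

import Mathlib

set_option autoImplicit false

/-! ### Asymptotic growth of functions `A* → ℕ` -/

/-- `g` has `k`-polynomial growth: `g(w) = O(|w|^k)` and there is an infinite set `L`
of words on which `g(w) = Ω(|w|^k)`. -/
def PolyGrowth {A : Type} (g : List A → ℕ) (k : ℕ) : Prop :=
  (∃ C : ℕ, ∀ w, g w ≤ C * w.length ^ k + C) ∧
  (∃ L : Set (List A), L.Infinite ∧ ∃ c : ℕ, 0 < c ∧ ∀ w ∈ L, w.length ^ k ≤ c * g w)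

/-- `g` has exponential growth: `g(w) = 2^{O(|w|)}` and there is an infinite set `L`
of words on which `g(w) = 2^{Ω(|w|)}`. -/
def ExpGrowth {A : Type} (g : List A → ℕ) : Prop :=
  (∃ C : ℕ, ∀ w, g w ≤ 2 ^ (C * w.length + C)) ∧
  (∃ L : Set (List A), L.Infinite ∧ ∃ c : ℕ, 0 < c ∧ ∀ w ∈ L, 2 ^ w.length ≤ (g w) ^ c)

/-! ### Substitutions -/

/-- Extension of a substitution `s : X → (B ⊎ X)*` to a morphism on `(B ⊎ X)*`
fixing the letters of `B`; this also gives the composition of substitutions,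
`(s₁ ∘ s₂) x = applySubst s₁ (s₂ x)`. -/
def applySubst {B X : Type} (s : X → List (B ⊕ X)) (l : List (B ⊕ X)) : List (B ⊕ X) :=
  l.flatMap (fun c => match c with | Sum.inl b => [Sum.inl b] | Sum.inr x => s x)

/-- Evaluation of a word over `B ⊎ X` under a valuation `v : X → B*` of the registers. -/
def evalSubst {B X : Type} (v : X → List B) (l : List (B ⊕ X)) : List B :=
  l.flatMap (fun c => match c with | Sum.inl b => [b] | Sum.inr x => v x)

/-- Number of occurrences of register `x` in a word over `B ⊎ X`. -/
noncomputable def occCount {B X : Type} (x : X) (l : List (B ⊕ X)) : ℕ :=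
  l.countP (fun c => @decide (c = Sum.inr x) (Classical.propDecidable _))

/-- Total number of occurrences of register `x` in the whole set of words `{s y | y ∈ X}`. -/
noncomputable def totalOcc {B X : Type} [Fintype X] (s : X → List (B ⊕ X)) (x : X) : ℕ :=
  ∑ y : X, occCount x (s y)

/-! ### Streaming string transducers -/

/-- A streaming string transducer (SST) with input alphabet `A` and output alphabet `B`:
finitely many states `Q` with initial state `q0`, finitely many registers `X` with
initial contents `init`, a partial transition/update function (`trans`, returning the
successor state together with the register update substitution, with a common domain),
and a partial output function `out`. -/
structure SST (A B : Type) where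
  Q : Type
  X : Type
  [finQ : Fintype Q]
  [finX : Fintype X]
  q0 : Q
  init : X → List B
  trans : Q → A → Option (Q × (X → List (B ⊕ X)))
  out : Q → Option (List (B ⊕ X))

attribute [instance] SST.finQ SST.finX

/-- Run of an SST from state `q` with current register valuation `v`. -/
def SST.runFrom {A B : Type} (T : SST A B) :
    T.Q → (T.X → List B) → List A → Option (T.Q × (T.X → List B))
  | q, v, [] => some (q, v)
  | q, v, a :: w =>
    match T.trans q a with
    | none => none
    | some (q', s) => T.runFrom q' (fun x => evalSubst v (s x)) w

/-- The (partial) function computed by an SST. -/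
def SST.eval {A B : Type} (T : SST A B) (w : List A) : Option (List B) :=
  (T.runFrom T.q0 T.init w).bind fun p => (T.out p.1).map fun o => evalSubst p.2 o

def SST.Computes {A B : Type} (T : SST A B) (f : List A → Option (List B)) : Prop :=
  ∀ w, T.eval w = f w

/-- An SST is copyless if every update substitution uses each register at most once
in total. -/
def SST.Copyless {A B : Type} (T : SST A B) : Prop :=
  ∀ q a p, T.trans q a = some p → ∀ x : T.X, totalOcc p.2 x ≤ 1

/-- An SST is `k`-layered if its registers can be partitioned into layers
`X_0, …, X_k` such that every update of a register of layer `i` only uses registers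
of layers `≤ i`, and each register of layer `i` is used at most once in total in the
updates of the registers of layer `i`. -/
def SST.IsLayered {A B : Type} (T : SST A B) (k : ℕ) : Prop :=
  ∃ layer : T.X → Fin (k + 1),
    ∀ q a p, T.trans q a = some p →
      (∀ x y, Sum.inr y ∈ p.2 x → layer y ≤ layer x) ∧
      (∀ y : T.X,
        (∑ x ∈ Finset.univ.filter (fun x => layer x = layer y), occCount y (p.2 x)) ≤ 1)

/-- The composed substitution `λ(q, w)` applied along the run reading `w` from state `q`
(together with the state reached). -/
def SST.substFrom {A B : Type} (T : SST A B) :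
    T.Q → List A → Option (T.Q × (T.X → List (B ⊕ T.X)))
  | q, [] => some (q, fun x => [Sum.inr x])
  | q, a :: w =>
    match T.trans q a with
    | none => none
    | some (q', s) => (T.substFrom q' w).map fun p => (p.1, fun x => applySubst s (p.2 x))

/-- An SST is `(k,B)`-bounded if its registers can be partitioned into layers
`X_0, …, X_k` such that every update of a register of layer `i` only uses registers of
layers `≤ i`, and for every state `q` and word `w`, each register of layer `i` occurs
at most `B` times in total in `{λ(q,w)(x) | x ∈ X_i}`. -/
def SST.IsBounded {A B : Type} (T : SST A B) (k Bd : ℕ) : Prop :=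
  ∃ layer : T.X → Fin (k + 1),
    (∀ q a p, T.trans q a = some p → ∀ x y, Sum.inr y ∈ p.2 x → layer y ≤ layer x) ∧
    (∀ q w p, T.substFrom q w = some p →
      ∀ y : T.X,
        (∑ x ∈ Finset.univ.filter (fun x => layer x = layer y), occCount y (p.2 x)) ≤ Bd)

/-! ### Simple SSTs -/

/-- A simple SST: total, a single state (hence no state component), and update
substitutions and output using no letters of `B`. -/
structure SimpleSST (A B : Type) where
  X : Type
  [finX : Fintype X]
  [decX : DecidableEq X]
  init : X → List B
  upd : A → X → List X
  out : List X

attribute [instance] SimpleSST.finX SimpleSST.decX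

/-- Register valuation of a simple SST after reading a word, starting from valuation `v`. -/
def SimpleSST.valFrom {A B : Type} (T : SimpleSST A B) :
    (T.X → List B) → List A → T.X → List B
  | v, [] => v
  | v, a :: w => T.valFrom (fun x => (T.upd a x).flatMap v) w

/-- Register valuation `𝒯^w` of a simple SST after reading `w`. -/
def SimpleSST.val {A B : Type} (T : SimpleSST A B) (w : List A) : T.X → List B :=
  T.valFrom T.init w

/-- The (total) function computed by a simple SST. -/
def SimpleSST.eval {A B : Type} (T : SimpleSST A B) (w : List A) : List B :=
  (T.out).flatMap (T.val w)

/-! ### Two-way transducers -/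

/-- A tape symbol: a letter of `A` or one of the two endmarkers `⊢`, `⊣`. -/
inductive TapeSym (A : Type) where
  | lend
  | rend
  | letter (a : A)

/-- The content of the tape `⊢w⊣` at position `m ∈ {0, …, |w|+1}`. -/
def tapeAt {A : Type} (w : List A) (m : ℕ) : TapeSym A :=
  if m = 0 then TapeSym.lend
  else
    match w[m - 1]? with
    | some a => TapeSym.letter a
    | none => TapeSym.rend

/-- Head moves. -/
inductive Dir where
  | left
  | right

/-- A deterministic two-way transducer: finitely many states with an initial state and
a set of final states, and a partial transition/output function (common domain). -/
structure TwoWayT (A B : Type) where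
  Q : Type
  [finQ : Fintype Q]
  q0 : Q
  final : Set Q
  trans : Q → TapeSym A → Option ((Q × Dir) × List B)

attribute [instance] TwoWayT.finQ

/-- `TwoWayT.Steps T w c v c'`: on input `⊢w⊣` the transducer can go from
configuration `c` to configuration `c'` producing output `v`. -/
inductive TwoWayT.Steps {A B : Type} (T : TwoWayT A B) (w : List A) :
    T.Q × ℕ → List B → T.Q × ℕ → Prop
  | refl (c : T.Q × ℕ) : TwoWayT.Steps T w c [] c
  | stepL {q : T.Q} {m : ℕ} {q' : T.Q} {v u : List B} {cf : T.Q × ℕ} :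
      T.trans q (tapeAt w m) = some ((q', Dir.left), v) → 1 ≤ m →
      TwoWayT.Steps T w (q', m - 1) u cf → TwoWayT.Steps T w (q, m) (v ++ u) cf
  | stepR {q : T.Q} {m : ℕ} {q' : T.Q} {v u : List B} {cf : T.Q × ℕ} :
      T.trans q (tapeAt w m) = some ((q', Dir.right), v) → m ≤ w.length →
      TwoWayT.Steps T w (q', m + 1) u cf → TwoWayT.Steps T w (q, m) (v ++ u) cf

/-- The two-way transducer computes the partial function `f`: `f w = some v` iff there
is an accepting run on `⊢w⊣` (from `(q0, 0)` to `(q, |w|+1)` with `q` final)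
producing `v`. -/
def TwoWayT.Computes {A B : Type} (T : TwoWayT A B) (f : List A → Option (List B)) : Prop :=
  ∀ w v, f w = some v ↔ ∃ q ∈ T.final, TwoWayT.Steps T w (T.q0, 0) v (q, w.length + 1)

/-! ### Marble transducers -/

/-- Actions of a marble transducer: move left, move right, lift the marble, or drop a
marble of color `c`. -/
inductive MAct (C : Type) where
  | left
  | right
  | lift
  | drop (c : C)

/-- A deterministic marble transducer: finitely many states with an initial state and a
set of final states, finitely many marble colors `C`, and a partial transition/output
function (common domain) reading the current state, the tape symbol, and the color of
the marble at the current position (if any); on a position carrying a marble the head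
may only move left or lift the marble. -/
structure MarbleT (A B : Type) where
  Q : Type
  C : Type
  [finQ : Fintype Q]
  [finC : Fintype C]
  q0 : Q
  final : Set Q
  trans : Q → TapeSym A → Option C → Option ((Q × MAct C) × List B)
  marble_left_or_lift : ∀ q s c p, trans q s (some c) = some p →
    p.1.2 = MAct.left ∨ p.1.2 = MAct.lift

attribute [instance] MarbleT.finQ MarbleT.finC

/-- The color of the marble at position `m`, for a stack `π` of dropped marbles
(topmost first, positions strictly increasing from the top and all ≥ the head
position). -/
def marbleAt {C : Type} (m : ℕ) : List (C × ℕ) → Option C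
  | [] => none
  | (c, p) :: _ => if p = m then some c else none

/-- `MarbleT.Steps T w c v c'`: on input `⊢w⊣` the marble transducer can go from
configuration `c` to configuration `c'` producing output `v`. A configuration is a
triple (state, head position, stack of dropped marbles). -/
inductive MarbleT.Steps {A B : Type} (T : MarbleT A B) (w : List A) :
    T.Q × ℕ × List (T.C × ℕ) → List B → T.Q × ℕ × List (T.C × ℕ) → Prop
  | refl (c : T.Q × ℕ × List (T.C × ℕ)) : MarbleT.Steps T w c [] c
  | stepL {q : T.Q} {m : ℕ} {π : List (T.C × ℕ)} {q' : T.Q} {v u : List B}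
      {cf : T.Q × ℕ × List (T.C × ℕ)} :
      T.trans q (tapeAt w m) (marbleAt m π) = some ((q', MAct.left), v) → 1 ≤ m →
      MarbleT.Steps T w (q', m - 1, π) u cf → MarbleT.Steps T w (q, m, π) (v ++ u) cf
  | stepR {q : T.Q} {m : ℕ} {π : List (T.C × ℕ)} {q' : T.Q} {v u : List B}
      {cf : T.Q × ℕ × List (T.C × ℕ)} :
      marbleAt m π = none →
      T.trans q (tapeAt w m) none = some ((q', MAct.right), v) → m ≤ w.length →
      MarbleT.Steps T w (q', m + 1, π) u cf → MarbleT.Steps T w (q, m, π) (v ++ u) cf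
  | stepLift {q : T.Q} {m : ℕ} {π : List (T.C × ℕ)} {q' : T.Q} {cc : T.C} {v u : List B}
      {cf : T.Q × ℕ × List (T.C × ℕ)} :
      T.trans q (tapeAt w m) (some cc) = some ((q', MAct.lift), v) →
      MarbleT.Steps T w (q', m, π) u cf →
      MarbleT.Steps T w (q, m, (cc, m) :: π) (v ++ u) cf
  | stepDrop {q : T.Q} {m : ℕ} {π : List (T.C × ℕ)} {q' : T.Q} {cc : T.C} {v u : List B}
      {cf : T.Q × ℕ × List (T.C × ℕ)} :
      marbleAt m π = none →
      T.trans q (tapeAt w m) none = some ((q', MAct.drop cc), v) →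
      MarbleT.Steps T w (q', m, (cc, m) :: π) u cf →
      MarbleT.Steps T w (q, m, π) (v ++ u) cf

/-- The marble transducer computes the partial function `f`: `f w = some v` iff there is
an accepting run on `⊢w⊣` (from `(q0, 0, ε)` to `(q, |w|+1, ε)` with `q` final)
producing `v`. -/
def MarbleT.Computes {A B : Type} (T : MarbleT A B) (f : List A → Option (List B)) : Prop :=
  ∀ w v, f w = some v ↔
    ∃ q ∈ T.final, MarbleT.Steps T w (T.q0, 0, []) v (q, w.length + 1, [])

/-- A `k`-marble transducer: every configuration reachable from the initial
configuration carries at most `k` marbles. -/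
def MarbleT.IsKMarble {A B : Type} (T : MarbleT A B) (k : ℕ) : Prop :=
  ∀ (w : List A) (u : List B) (cfg : T.Q × ℕ × List (T.C × ℕ)),
    MarbleT.Steps T w (T.q0, 0, []) u cfg → cfg.2.2.length ≤ k

/-- `f` is computable by a `k`-marble transducer. -/
def ComputableKMarble {A B : Type} (f : List A → List B) (k : ℕ) : Prop :=
  ∃ T : MarbleT A B, T.IsKMarble k ∧ T.Computes (fun w => some (f w))

/-! ### Matrices over ℕ and ℕ-automata -/

/-- Product of two square matrices over `ℕ` (given as functions). -/
def matMul {Q : Type} [Fintype Q] (M N : Q → Q → ℕ) : Q → Q → ℕ :=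
  fun i j => ∑ x : Q, M i x * N x j

/-- Identity matrix over `ℕ`. -/
def matId {Q : Type} [DecidableEq Q] : Q → Q → ℕ :=
  fun i j => if i = j then 1 else 0

/-- Row vector times matrix. -/
def vecMat {Q : Type} [Fintype Q] (v : Q → ℕ) (M : Q → Q → ℕ) : Q → ℕ :=
  fun j => ∑ x : Q, v x * M x j

/-- Matrix times column vector. -/
def matVec {Q : Type} [Fintype Q] (M : Q → Q → ℕ) (v : Q → ℕ) : Q → ℕ :=
  fun i => ∑ x : Q, M i x * v x

/-- Dot product of two vectors over `ℕ`. -/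
def dotProd {Q : Type} [Fintype Q] (v w : Q → ℕ) : ℕ :=
  ∑ x : Q, v x * w x

/-- An `ℕ`-automaton: a finite set of states `Q`, an initial row vector `α`, a weight
matrix `μ a` for every letter `a` (extended to words as a monoid morphism `μW`), and a
final column vector `β`. -/
structure NAut (A : Type) where
  Q : Type
  [finQ : Fintype Q]
  [decQ : DecidableEq Q]
  α : Q → ℕ
  μ : A → Q → Q → ℕ
  β : Q → ℕ

attribute [instance] NAut.finQ NAut.decQ

/-- The monoid morphism `A* → ℕ^{Q×Q}` extending `μ`. -/
def NAut.μW {A : Type} (T : NAut A) : List A → T.Q → T.Q → ℕ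
  | [] => matId
  | a :: w => matMul (T.μ a) (T.μW w)

/-- The total function `g : A* → ℕ` computed by the `ℕ`-automaton: `g w = α·μ(w)·β`. -/
def NAut.g {A : Type} (T : NAut A) (w : List A) : ℕ :=
  dotProd (vecMat T.α (T.μW w)) T.β

/-- Trimness: every state is accessible and co-accessible with nonzero weight. -/
def NAut.Trim {A : Type} (T : NAut A) : Prop :=
  ∀ q : T.Q, (∃ u, 1 ≤ vecMat T.α (T.μW u) q) ∧ (∃ v, 1 ≤ matVec (T.μW v) T.β q)

/-- A heavy cycle on state `q`: a nonempty word `v` with `μ(v)(q,q) ≥ 2`. -/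
def NAut.HeavyCycle {A : Type} (T : NAut A) (q : T.Q) (v : List A) : Prop :=
  v ≠ [] ∧ 2 ≤ T.μW v q q

/-- A barbell from `q` to `q' ≠ q`: a nonempty word `v` with `μ(v)(q,q) ≥ 1`,
`μ(v)(q,q') ≥ 1` and `μ(v)(q',q') ≥ 1`. -/
def NAut.Barbell {A : Type} (T : NAut A) (q q' : T.Q) (v : List A) : Prop :=
  q ≠ q' ∧ v ≠ [] ∧ 1 ≤ T.μW v q q ∧ 1 ≤ T.μW v q q' ∧ 1 ≤ T.μW v q' q'

/-- Edge of the barbell graph `𝔊`. -/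
def NAut.GEdge {A : Type} (T : NAut A) (q1 q2 : T.Q) : Prop :=
  ∃ q q' v, T.Barbell q q' v ∧ (∃ w, 1 ≤ T.μW w q1 q) ∧ (∃ w', 1 ≤ T.μW w' q' q2)

/-- `PathLen G q n`: there is a directed path of length `n` (counting edges) in the
graph `G` ending in `q`. -/
inductive PathLen {Q : Type} (G : Q → Q → Prop) : Q → ℕ → Prop
  | zero (q : Q) : PathLen G q 0
  | succ {p q : Q} {n : ℕ} : PathLen G p n → G p q → PathLen G q (n + 1)

/-- The height of `q` in the graph `G` is `n`: the maximal length of a directed path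
ending in `q` is `n`. -/
def HeightIs {Q : Type} (G : Q → Q → Prop) (q : Q) (n : ℕ) : Prop :=
  PathLen G q n ∧ ∀ m, PathLen G q m → m ≤ n

/-! ### Statement-specific predicates -/

/-- Case (1) of the trichotomy: `|f|` has exponential growth and `f` is not computable
with `k` marbles for any `k`. -/
def MarbleCase1 {A B : Type} (f : List A → List B) : Prop :=
  ExpGrowth (fun w => (f w).length) ∧ ∀ k : ℕ, ¬ ComputableKMarble f k

/-- Case (2) of the trichotomy: `|f|` has `(k+1)`-polynomial growth for some `k`, `f` is
computable with `k` marbles, and `k` is the least possible number of marbles. -/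
def MarbleCase2 {A B : Type} (f : List A → List B) : Prop :=
  ∃ k : ℕ, PolyGrowth (fun w => (f w).length) (k + 1) ∧ ComputableKMarble f k ∧
    ∀ j : ℕ, ComputableKMarble f j → k ≤ j

/-- Case (3) of the trichotomy: `|f|` has `0`-polynomial growth and `f` is computable
with `0` marbles. -/
def MarbleCase3 {A B : Type} (f : List A → List B) : Prop :=
  PolyGrowth (fun w => (f w).length) 0 ∧ ComputableKMarble f 0

/-- The second alternative of Lemma `lem:graph`: `g` has `k`-polynomial growth for some
`k ≥ 0` and the states admit a partition `S_0, …, S_k` satisfying (a), (b), (c). -/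
def NAutPolyCase {A : Type} (T : NAut A) : Prop :=
  ∃ k : ℕ, PolyGrowth T.g k ∧
    ∃ S : T.Q → Fin (k + 1),
      (∀ q q' : T.Q, (∃ w, 1 ≤ T.μW w q q') → S q ≤ S q') ∧
      (∃ Bd : ℕ, ∀ q q' : T.Q, S q = S q' → ∀ w, T.μW w q q' ≤ Bd) ∧
      (∀ q : T.Q, ∃ C : ℕ, ∀ w, vecMat T.α (T.μW w) q ≤ C * w.length ^ (S q : ℕ) + C)



/-! ## Part A : a `k`-marble transducer has growth `O(n^(k+1))` -/

namespace PartA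

theorem poly_shift (c d : ℕ) (n : ℕ) : (n + c) ^ d ≤ (c + 1) ^ d * n ^ d + (c + 1) ^ d := by
  rcases Nat.eq_zero_or_pos n with h | h
  · subst h
    calc (0 + c) ^ d ≤ (c + 1) ^ d := Nat.pow_le_pow_left (by omega) d
      _ ≤ _ := Nat.le_add_left _ _
  · calc (n + c) ^ d ≤ ((c + 1) * n) ^ d := Nat.pow_le_pow_left (by nlinarith) d
      _ = (c + 1) ^ d * n ^ d := mul_pow _ _ _
      _ ≤ _ := Nat.le_add_right _ _

variable {A B : Type}

/-- A single step. -/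
inductive Step1 (T : MarbleT A B) (w : List A) :
    T.Q × ℕ × List (T.C × ℕ) → List B → T.Q × ℕ × List (T.C × ℕ) → Prop
  | L {q : T.Q} {m : ℕ} {π : List (T.C × ℕ)} {q' : T.Q} {v : List B} :
      T.trans q (tapeAt w m) (marbleAt m π) = some ((q', MAct.left), v) → 1 ≤ m →
      Step1 T w (q, m, π) v (q', m - 1, π)
  | R {q : T.Q} {m : ℕ} {π : List (T.C × ℕ)} {q' : T.Q} {v : List B} :
      marbleAt m π = none →
      T.trans q (tapeAt w m) none = some ((q', MAct.right), v) → m ≤ w.length →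
      Step1 T w (q, m, π) v (q', m + 1, π)
  | lift {q : T.Q} {m : ℕ} {π : List (T.C × ℕ)} {q' : T.Q} {cc : T.C} {v : List B} :
      T.trans q (tapeAt w m) (some cc) = some ((q', MAct.lift), v) →
      Step1 T w (q, m, (cc, m) :: π) v (q', m, π)
  | drop {q : T.Q} {m : ℕ} {π : List (T.C × ℕ)} {q' : T.Q} {cc : T.C} {v : List B} :
      marbleAt m π = none →
      T.trans q (tapeAt w m) none = some ((q', MAct.drop cc), v) →
      Step1 T w (q, m, π) v (q', m, (cc, m) :: π)

theorem Step1.cons {T : MarbleT A B} {w : List A} {c c' d v u} (h : Step1 T w c v c')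
    (h2 : MarbleT.Steps T w c' u d) : MarbleT.Steps T w c (v ++ u) d := by
  cases h with
  | L h1 hm => exact .stepL h1 hm h2
  | R h0 h1 hm => exact .stepR h0 h1 hm h2
  | lift h1 => exact .stepLift h1 h2
  | drop h0 h1 => exact .stepDrop h0 h1 h2

theorem Step1.one {T : MarbleT A B} {w : List A} {c c' v} (h : Step1 T w c v c') :
    MarbleT.Steps T w c v c' := by
  simpa using h.cons (.refl _)

/-- Case analysis of runs by head steps. -/
theorem Steps_elim {T : MarbleT A B} {w : List A}
    {P : T.Q × ℕ × List (T.C × ℕ) → List B → T.Q × ℕ × List (T.C × ℕ) → Prop}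
    (h0 : ∀ c, P c [] c)
    (h1 : ∀ c v c' u d, Step1 T w c v c' → MarbleT.Steps T w c' u d → P c' u d → P c (v ++ u) d)
    {c v d} (h : MarbleT.Steps T w c v d) : P c v d := by
  induction h with
  | refl c => exact h0 c
  | stepL a b c ih => exact h1 _ _ _ _ _ (.L a b) c ih
  | stepR a b d c ih => exact h1 _ _ _ _ _ (.R a b d) c ih
  | stepLift a c ih => exact h1 _ _ _ _ _ (.lift a) c ih
  | stepDrop a b c ih => exact h1 _ _ _ _ _ (.drop a b) c ih

theorem Steps_trans {T : MarbleT A B} {w : List A} {c v d u e} (h : MarbleT.Steps T w c v d)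
    (h2 : MarbleT.Steps T w d u e) : MarbleT.Steps T w c (v ++ u) e := by
  refine Steps_elim (P := fun c v d => MarbleT.Steps T w d u e → MarbleT.Steps T w c (v ++ u) e)
    ?_ ?_ h h2
  · intro c h; simpa using h
  · intro c v c' u' d hs _ ih h
    rw [List.append_assoc]; exact hs.cons (ih h)

/-- paths recording the visited configurations -/
inductive Path (T : MarbleT A B) (w : List A) :
    T.Q × ℕ × List (T.C × ℕ) → List (T.Q × ℕ × List (T.C × ℕ)) → List B →
      T.Q × ℕ × List (T.C × ℕ) → Prop
  | nil (c) : Path T w c [c] [] c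
  | cons {c v c' l u d} : Step1 T w c v c' → Path T w c' l u d → Path T w c (c :: l) (v ++ u) d

theorem Path.steps {T : MarbleT A B} {w : List A} {c l v d} (h : Path T w c l v d) :
    MarbleT.Steps T w c v d := by
  induction h with
  | nil c => exact .refl _
  | cons a _ ih => exact a.cons ih

theorem Path.suffix {T : MarbleT A B} {w : List A} {c l v d} (h : Path T w c l v d) :
    ∀ x ∈ l, ∃ l' v', Path T w x l' v' d ∧ l'.Sublist l := by
  induction h with
  | nil c => intro x hx; simp at hx; subst hx; exact ⟨_, _, .nil _, List.Sublist.refl _⟩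
  | @cons c v c' l u d a p ih =>
    intro x hx
    rcases List.mem_cons.1 hx with rfl | hx
    · exact ⟨_, _, .cons a p, List.Sublist.refl _⟩
    · obtain ⟨l', v', h1, h2⟩ := ih x hx
      exact ⟨l', v', h1, h2.cons _⟩

theorem exists_path {T : MarbleT A B} {w : List A} {c v d} (h : MarbleT.Steps T w c v d) :
    ∃ l v', Path T w c l v' d ∧ l.Nodup := by
  refine Steps_elim (P := fun c v d => ∃ l v', Path T w c l v' d ∧ l.Nodup) ?_ ?_ h
  · intro c; exact ⟨_, _, .nil c, by simp⟩
  · rintro c v c' u d hs _ ⟨l, v', hp, hn⟩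
    by_cases hc : c ∈ l
    · obtain ⟨l', v'', h1, h2⟩ := hp.suffix c hc
      exact ⟨l', v'', h1, hn.sublist h2⟩
    · exact ⟨_, _, .cons hs hp, List.nodup_cons.2 ⟨hc, hn⟩⟩

theorem Path.len {T : MarbleT A B} {w : List A} {M : ℕ}
    (hM : ∀ q s o p, T.trans q s o = some p → p.2.length ≤ M)
    {c l v d} (h : Path T w c l v d) : v.length ≤ M * l.length := by
  induction h with
  | nil c => simp
  | cons a p ih =>
    have : ∀ {c v c'}, Step1 T w c v c' → v.length ≤ M := by
      intro c v c' h
      cases h with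
      | L h1 _ => exact hM _ _ _ _ h1
      | R _ h1 _ => exact hM _ _ _ _ h1
      | lift h1 => exact hM _ _ _ _ h1
      | drop _ h1 => exact hM _ _ _ _ h1
    have h1 := this a
    simp only [List.length_append, List.length_cons]
    nlinarith

/-- valid configuration -/
def Valid (T : MarbleT A B) (w : List A) (c : T.Q × ℕ × List (T.C × ℕ)) : Prop :=
  c.2.1 ≤ w.length + 1 ∧ ∀ x ∈ c.2.2, x.2 ≤ w.length + 1

theorem Step1.valid {T : MarbleT A B} {w : List A} {c v d} (h : Step1 T w c v d)
    (hv : Valid T w c) : Valid T w d := by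
  obtain ⟨h1, h2⟩ := hv
  cases h with
  | L _ _ => exact ⟨by simp at *; omega, h2⟩
  | R _ _ hm => exact ⟨by simp at *; omega, h2⟩
  | lift _ => exact ⟨h1, fun x hx => h2 x (List.mem_cons_of_mem _ hx)⟩
  | drop _ _ => exact ⟨h1, fun x hx => by
      rcases List.mem_cons.1 hx with rfl | hx
      · exact h1
      · exact h2 x hx⟩

theorem Path.all {T : MarbleT A B} {w : List A} {c l v d} (h : Path T w c l v d)
    (P : T.Q × ℕ × List (T.C × ℕ) → Prop) (hP : ∀ c v d, Step1 T w c v d → P c → P d) (hc : P c) :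
    ∀ x ∈ l, P x := by
  induction h with
  | nil c => intro x hx; simp at hx; subst hx; exact hc
  | cons a _ ih =>
    intro x hx
    rcases List.mem_cons.1 hx with rfl | hx
    · exact hc
    · exact ih (hP _ _ _ a hc) x hx

noncomputable def enc (T : MarbleT A B) (n k : ℕ) (c : T.Q × ℕ × List (T.C × ℕ)) :
    T.Q × Fin (n + 2) × (Fin k → Option (T.C × Fin (n + 2))) :=
  (c.1, Fin.ofNat (n + 2) c.2.1, fun i => (c.2.2[i.1]?).map fun x => (x.1, Fin.ofNat (n + 2) x.2))

theorem enc_inj (T : MarbleT A B) (w : List A) (k : ℕ) {c d : T.Q × ℕ × List (T.C × ℕ)}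
    (hc : Valid T w c) (hd : Valid T w d) (hck : c.2.2.length ≤ k) (hdk : d.2.2.length ≤ k)
    (h : enc T w.length k c = enc T w.length k d) : c = d := by
  obtain ⟨q, m, π⟩ := c
  obtain ⟨q', m', π'⟩ := d
  simp only [enc, Prod.mk.injEq] at h
  obtain ⟨h1, h2, h3⟩ := h
  have e2 : m = m' := by
    have := congrArg Fin.val h2
    simp only [Fin.ofNat] at this
    have a := hc.1
    have b := hd.1
    simp only at a b
    rwa [Nat.mod_eq_of_lt (by omega), Nat.mod_eq_of_lt (by omega)] at this
  subst h1 e2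
  congr 2
  apply List.ext_getElem?
  intro i
  by_cases hi : i < k
  · have := congrFun h3 ⟨i, hi⟩
    simp only at this
    rcases e : π[i]? with _ | ⟨c1, p1⟩ <;> rcases e' : π'[i]? with _ | ⟨c2, p2⟩
    · rfl
    · simp [e, e'] at this
    · simp [e, e'] at this
    · rw [e, e'] at this
      simp only [Option.map_some, Option.some.injEq, Prod.mk.injEq] at this
      obtain ⟨rfl, h5⟩ := this
      have a := hc.2 _ (List.mem_of_getElem? e)
      have b := hd.2 _ (List.mem_of_getElem? e')
      simp only at a b
      have := congrArg Fin.val h5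
      simp only [Fin.ofNat] at this
      rw [Nat.mod_eq_of_lt (by omega), Nat.mod_eq_of_lt (by omega)] at this
      rw [this]
  · simp only at hck hdk
    rw [List.getElem?_eq_none (by omega), List.getElem?_eq_none (by omega)]

instance finiteTape [Finite A] : Finite (TapeSym A) := by
  refine Finite.of_surjective (α := Option (Option A))
    (fun o => match o with | none => .lend | some none => .rend | some (some a) => .letter a) ?_
  rintro (_ | _ | a)
  · exact ⟨none, rfl⟩
  · exact ⟨some none, rfl⟩
  · exact ⟨some (some a), rfl⟩

theorem exists_bound {ι : Type} [Finite ι] (g : ι → ℕ) : ∃ M, ∀ i, g i ≤ M := by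
  obtain ⟨M, hM⟩ := (Set.finite_range g).bddAbove
  exact ⟨M, fun i => hM ⟨i, rfl⟩⟩

theorem growth [Fintype A] (f : List A → List B) (k : ℕ)
    (h : ComputableKMarble f k) :
    ∃ C : ℕ, ∀ w, (f w).length ≤ C * w.length ^ (k + 1) + C := by
  obtain ⟨T, hk, hT⟩ := h
  obtain ⟨M, hM⟩ : ∃ M, ∀ q s o p, T.trans q s o = some p → p.2.length ≤ M := by
    obtain ⟨M, hM⟩ := exists_bound (fun x : T.Q × TapeSym A × Option T.C =>
      match T.trans x.1 x.2.1 x.2.2 with | none => 0 | some p => p.2.length)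
    refine ⟨M, fun q s o p h => ?_⟩
    have := hM (q, s, o)
    simpa [h] using this
  set D := M * (Fintype.card T.Q * (Fintype.card T.C + 1) ^ k) with hD
  refine ⟨D * 3 ^ (k + 1), fun w => ?_⟩
  obtain ⟨q, hq, hs⟩ := (hT w (f w)).1 rfl
  obtain ⟨l, v, hp, hn⟩ := exists_path hs
  have hv : f w = v := by
    have := (hT w v).2 ⟨q, hq, hp.steps⟩
    simpa using this
  have hl := hp.len hM
  have hval := hp.all (Valid T w) (fun _ _ _ h => h.valid) ⟨by simp, by simp⟩
  have hkk : ∀ x ∈ l, x.2.2.length ≤ k := by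
    have := hp.all (fun c => ∃ u, MarbleT.Steps T w (T.q0, 0, []) u c)
      (fun c v d h ⟨u, hu⟩ => ⟨_, Steps_trans hu h.one⟩) ⟨_, .refl _⟩
    intro x hx
    obtain ⟨u, hu⟩ := this x hx
    exact hk w u x hu
  have hcard : l.length ≤ Fintype.card T.Q * ((w.length + 2) *
      (Fintype.card T.C * (w.length + 2) + 1) ^ k) := by
    classical
    have : (l.map (enc T w.length k)).Nodup := by
      refine List.Nodup.map_on ?_ hn
      intro x hx y hy hxy
      exact enc_inj T w k (hval x hx) (hval y hy) (hkk x hx) (hkk y hy) hxy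
    have h2 := this.length_le_card
    simpa using h2
  rw [hv]
  calc v.length ≤ M * l.length := hl
    _ ≤ M * (Fintype.card T.Q * ((w.length + 2) *
      (Fintype.card T.C * (w.length + 2) + 1) ^ k)) := Nat.mul_le_mul_left _ hcard
    _ ≤ M * (Fintype.card T.Q * ((w.length + 2) *
      ((Fintype.card T.C + 1) * (w.length + 2)) ^ k)) := by
        gcongr
        nlinarith
    _ = D * (w.length + 2) ^ (k + 1) := by rw [hD, mul_pow, pow_succ]; ring
    _ ≤ D * (3 ^ (k + 1) * w.length ^ (k + 1) + 3 ^ (k + 1)) :=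
        Nat.mul_le_mul_left _ (poly_shift 2 (k + 1) w.length)
    _ = _ := by ring

end PartA


/-! ## Part B : from a marble transducer to an HDT0L system -/

/-- Value of the registers of an HDT0L system (`r` is the reversed input read so far). -/
def hval {A B X : Type} (upd : A → X → List X) (init : X → List B) : List A → X → List B
  | [] => init
  | a :: r => fun x => (upd a x).flatMap (hval upd init r)

namespace PartB
open PartA

variable {A B : Type}

open Classical in
noncomputable def locStep (T : MarbleT A B) (e : Option T.Q → Option T.Q) (s : TapeSym A)
    (c : T.Q × Option T.C) : Option (List (B ⊕ Option T.Q) × ((T.Q × Option T.C) ⊕ T.Q)) :=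
  if s = TapeSym.rend ∧ c.1 ∈ T.final ∧ c.2 = none then some ([], Sum.inr c.1)
  else match T.trans c.1 s c.2 with
    | none => none
    | some ((q', MAct.left), v) =>
      match e (some q') with
      | none => none
      | some q'' => some (v.map Sum.inl ++ [Sum.inr (some q')], Sum.inl (q'', c.2))
    | some ((q', MAct.right), v) =>
      if c.2 = none ∧ s ≠ TapeSym.rend then some (v.map Sum.inl, Sum.inr q') else none
    | some ((q', MAct.lift), v) =>
      if c.2 = none then none else some (v.map Sum.inl, Sum.inl (q', none))
    | some ((q', MAct.drop cc), v) =>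
      if c.2 = none then some (v.map Sum.inl, Sum.inl (q', some cc)) else none

inductive Loc (T : MarbleT A B) (e : Option T.Q → Option T.Q) (s : TapeSym A) :
    T.Q × Option T.C → List (B ⊕ Option T.Q) → T.Q → Prop
  | exit {c l q} : locStep T e s c = some (l, Sum.inr q) → Loc T e s c l q
  | cont {c l c' l' q} : locStep T e s c = some (l, Sum.inl c') → Loc T e s c' l' q →
      Loc T e s c (l ++ l') q

theorem Loc.uniq {T : MarbleT A B} {e : Option T.Q → Option T.Q} {s : TapeSym A} {c l q}
    (h : Loc T e s c l q) : ∀ {l' q'}, Loc T e s c l' q' → l = l' ∧ q = q' := by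
  induction h with
  | exit h =>
    intro l' q' h'
    cases h' with
    | exit h2 => rw [h] at h2; simpa using h2
    | cont h2 _ => rw [h] at h2; simp at h2
  | cont h _ ih =>
    intro l' q' h'
    cases h' with
    | exit h2 => rw [h] at h2; simp at h2
    | cont h2 h3 =>
      rw [h] at h2
      simp only [Option.some.injEq, Prod.mk.injEq, Sum.inl.injEq] at h2
      obtain ⟨rfl, rfl⟩ := h2
      obtain ⟨rfl, rfl⟩ := ih h3
      exact ⟨rfl, rfl⟩

open Classical in
noncomputable def start (T : MarbleT A B) (e : Option T.Q → Option T.Q) (s : TapeSym A) :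
    Option T.Q → Option (List (B ⊕ Option T.Q) × T.Q)
  | some p => some ([], p)
  | none => if s = TapeSym.lend then some ([], T.q0) else (e none).map fun q => ([Sum.inr none], q)

open Classical in
noncomputable def res (T : MarbleT A B) (e : Option T.Q → Option T.Q) (s : TapeSym A)
    (x : Option T.Q) : Option (List (B ⊕ Option T.Q) × T.Q) :=
  match start T e s x with
  | none => none
  | some (l0, p) =>
    if h : ∃ r : List (B ⊕ Option T.Q) × T.Q, Loc T e s (p, none) r.1 r.2 then
      some (l0 ++ h.choose.1, h.choose.2) else none

theorem res_eq {T : MarbleT A B} {e : Option T.Q → Option T.Q} {s : TapeSym A} {x l0 p l q}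
    (h1 : start T e s x = some (l0, p)) (h2 : Loc T e s (p, none) l q) :
    res T e s x = some (l0 ++ l, q) := by
  have h : ∃ r : List (B ⊕ Option T.Q) × T.Q, Loc T e s (p, none) r.1 r.2 := ⟨(l, q), h2⟩
  obtain ⟨h3, h4⟩ := h.choose_spec.uniq h2
  rw [res, h1]
  simp only [dif_pos h]
  rw [h3, h4]

theorem res_spec {T : MarbleT A B} {e : Option T.Q → Option T.Q} {s : TapeSym A} {x l q}
    (h : res T e s x = some (l, q)) : ∃ l0 p l', start T e s x = some (l0, p) ∧
      Loc T e s (p, none) l' q ∧ l = l0 ++ l' := by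
  rw [res] at h
  rcases hs : start T e s x with _ | ⟨l0, p⟩
  · simp [hs] at h
  · rw [hs] at h
    simp only at h
    split_ifs at h with h'
    simp only [Option.some.injEq, Prod.mk.injEq] at h
    exact ⟨l0, p, h'.choose.1, rfl, h.2 ▸ h'.choose_spec, h.1.symm⟩

noncomputable def nextE (T : MarbleT A B) (e : Option T.Q → Option T.Q) (s : TapeSym A)
    (x : Option T.Q) : Option T.Q := (res T e s x).map Prod.snd

noncomputable def outl (T : MarbleT A B) (e : Option T.Q → Option T.Q) (s : TapeSym A)
    (x : Option T.Q) : List (B ⊕ Option T.Q) := ((res T e s x).map Prod.fst).getD []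

noncomputable def eAt (T : MarbleT A B) (w : List A) : ℕ → Option T.Q → Option T.Q
  | 0 => fun _ => none
  | t + 1 => nextE T (eAt T w t) (tapeAt w t)

noncomputable def VAt (T : MarbleT A B) (w : List A) : ℕ → Option T.Q → List B
  | 0 => fun _ => []
  | t + 1 => fun x => evalSubst (VAt T w t) (outl T (eAt T w t) (tapeAt w t) x)

def Above {C : Type} (m : ℕ) (π : List (C × ℕ)) : Prop := ∀ x ∈ π.head?, m < x.2

def stk {C : Type} (o : Option C) (m : ℕ) (π : List (C × ℕ)) : List (C × ℕ) :=
  match o with | none => π | some c => (c, m) :: π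

theorem marbleAt_stk {C : Type} (o : Option C) (m : ℕ) (π : List (C × ℕ)) (h : Above m π) :
    marbleAt m (stk o m π) = o := by
  cases o with
  | some c => simp [stk, marbleAt]
  | none =>
    cases π with
    | nil => rfl
    | cons x π =>
      obtain ⟨c, p⟩ := x
      have := h (c, p) (by simp)
      simp only at this
      simp only [stk, marbleAt]
      rw [if_neg (by omega)]

theorem above_pred {C : Type} (o : Option C) (m : ℕ) (π : List (C × ℕ)) (h : Above m π)
    (hm : 1 ≤ m) : Above (m - 1) (stk o m π) := by
  cases o with
  | some c => intro x hx; simp [stk] at hx; subst hx; simp; omega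
  | none => intro x hx; have := h x hx; omega

theorem evalSubst_append {B X : Type} (v : X → List B) (l l' : List (B ⊕ X)) :
    evalSubst v (l ++ l') = evalSubst v l ++ evalSubst v l' := by
  simp [evalSubst]

theorem evalSubst_inl {B X : Type} (v : X → List B) (l : List B) :
    evalSubst v (l.map Sum.inl) = l := by
  induction l with
  | nil => rfl
  | cons b l ih => simp [evalSubst] at *; exact ih

theorem evalSubst_inr {B X : Type} (v : X → List B) (x : X) :
    evalSubst v [Sum.inr x] = v x := by
  simp [evalSubst]

theorem tapeAt_rend {w : List A} {m : ℕ} : tapeAt w m = TapeSym.rend ↔ w.length + 1 ≤ m := by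
  unfold tapeAt
  rcases Nat.eq_zero_or_pos m with h | h
  · subst h; simp
  · rw [if_neg (by omega)]
    by_cases h2 : m - 1 < w.length
    · rw [List.getElem?_eq_getElem h2]; simp; omega
    · rw [List.getElem?_eq_none (by omega)]; simp; omega

theorem tapeAt_lend {w : List A} {m : ℕ} : tapeAt w m = TapeSym.lend ↔ m = 0 := by
  unfold tapeAt
  rcases Nat.eq_zero_or_pos m with h | h
  · subst h; simp
  · rw [if_neg (by omega)]
    by_cases h2 : m - 1 < w.length
    · rw [List.getElem?_eq_getElem h2]; simp; omega
    · rw [List.getElem?_eq_none (by omega)]; simp; omega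

theorem tapeAt_letter {w : List A} {m : ℕ} (h : m < w.length) :
    tapeAt w (m + 1) = TapeSym.letter w[m] := by
  simp [tapeAt, h]

/-- soundness of `eAt` at level `t` -/
def Snd (T : MarbleT A B) (w : List A) (t : ℕ) : Prop :=
  ∀ p q, eAt T w t (some p) = some q → 1 ≤ t ∧ ∀ π, Above (t - 1) π →
    MarbleT.Steps T w (p, t - 1, π) (VAt T w t (some p)) (q, t, π)

theorem loc_sound {T : MarbleT A B} {w : List A} {t : ℕ} (hS : Snd T w t)
    (ht : t ≤ w.length + 1) {c l q} (h : Loc T (eAt T w t) (tapeAt w t) c l q) :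
    ∀ π, Above t π →
      MarbleT.Steps T w (c.1, t, stk c.2 t π) (evalSubst (VAt T w t) l)
        (q, min (t + 1) (w.length + 1), π) ∧ (t = w.length + 1 → q ∈ T.final) := by
  induction h with
  | @exit c l q h =>
    intro π hπ
    obtain ⟨q0, o⟩ := c
    have hma := marbleAt_stk o t π hπ
    unfold locStep at h
    simp only at h
    by_cases hacc : tapeAt w t = TapeSym.rend ∧ q0 ∈ T.final ∧ o = none
    · rw [if_pos hacc] at h
      obtain ⟨h1, h2, rfl⟩ := hacc
      simp only [Option.some.injEq, Prod.mk.injEq, Sum.inr.injEq] at h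
      obtain ⟨rfl, rfl⟩ := h
      rw [tapeAt_rend] at h1
      refine ⟨?_, fun _ => h2⟩
      rw [Nat.min_eq_right (by omega), show t = w.length + 1 by omega]
      exact .refl _
    · rw [if_neg hacc] at h
      split at h
      · simp at h
      · split at h <;> simp at h
      · rename_i q' v htr
        split_ifs at h with h2
        obtain ⟨rfl, h2⟩ := h2
        simp only [Option.some.injEq, Prod.mk.injEq, Sum.inr.injEq] at h
        obtain ⟨rfl, rfl⟩ := h
        rw [Ne, tapeAt_rend] at h2
        refine ⟨?_, fun h => by omega⟩
        rw [evalSubst_inl, Nat.min_eq_left (by omega)]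
        exact (Step1.R hma htr (by omega)).one
      · split_ifs at h <;> simp at h
      · split_ifs at h; simp at h
  | @cont c l c' l' q h _ ih =>
    intro π hπ
    obtain ⟨q0, o⟩ := c
    have hma := marbleAt_stk o t π hπ
    unfold locStep at h
    simp only at h
    by_cases hacc : tapeAt w t = TapeSym.rend ∧ q0 ∈ T.final ∧ o = none
    · rw [if_pos hacc] at h
      simp at h
    · rw [if_neg hacc] at h
      split at h
      · simp at h
      · rename_i q' v htr
        split at h
        · simp at h
        · rename_i q'' hq
          simp only [Option.some.injEq, Prod.mk.injEq, Sum.inl.injEq] at h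
          obtain ⟨rfl, rfl⟩ := h
          obtain ⟨h1, h2⟩ := hS _ _ hq
          obtain ⟨ih1, ih2⟩ := ih π hπ
          refine ⟨?_, ih2⟩
          simp only [evalSubst_append, evalSubst_inl, evalSubst_inr, List.append_assoc]
          refine Step1.cons (Step1.L (by rw [hma]; exact htr) h1) ?_
          exact Steps_trans (h2 _ (above_pred o t π hπ h1)) ih1
      · split_ifs at h; simp at h
      · rename_i q' v htr
        split_ifs at h with ho
        simp only [Option.some.injEq, Prod.mk.injEq, Sum.inl.injEq] at h
        obtain ⟨rfl, rfl⟩ := h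
        obtain ⟨ih1, ih2⟩ := ih π hπ
        refine ⟨?_, ih2⟩
        simp only [evalSubst_append, evalSubst_inl]
        rcases o with _ | cc
        · exact absurd rfl ho
        exact Step1.cons (Step1.lift htr) ih1
      · rename_i q' cc v htr
        split_ifs at h with ho
        subst ho
        simp only [Option.some.injEq, Prod.mk.injEq, Sum.inl.injEq] at h
        obtain ⟨rfl, rfl⟩ := h
        obtain ⟨ih1, ih2⟩ := ih π hπ
        refine ⟨?_, ih2⟩
        simp only [evalSubst_append, evalSubst_inl]
        exact Step1.cons (Step1.drop hma htr) ih1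

theorem snd_all {T : MarbleT A B} {w : List A} : ∀ t, t ≤ w.length + 1 → Snd T w t
  | 0, _ => by intro p q h; simp [eAt] at h
  | t + 1, ht => by
    have ih := snd_all (T := T) (w := w) t (by omega)
    intro p q h
    refine ⟨by omega, fun π hπ => ?_⟩
    simp only [eAt, nextE, Option.map_eq_some_iff] at h
    obtain ⟨⟨l, q'⟩, h1, rfl⟩ := h
    obtain ⟨l0, p', l', h2, h3, rfl⟩ := res_spec h1
    simp only [start, Option.some.injEq, Prod.mk.injEq] at h2
    obtain ⟨rfl, rfl⟩ := h2
    have := (loc_sound ih (by omega) h3 π hπ).1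
    rw [Nat.min_eq_left (by omega)] at this
    simpa [VAt, outl, h1, stk] using this

/-- Completeness at level `t` (for excursions at position `t - 1`). -/
def Cmp (T : MarbleT A B) (w : List A) (t : ℕ) : Prop :=
  ∀ m, t = m + 1 → ∀ p π l v qf, Above m π → qf ∈ T.final →
    Path T w (p, m, π) l v (qf, w.length + 1, []) →
    ∃ q', eAt T w t (some p) = some q' ∧
      ∃ l' v', Path T w (q', t, π) l' v' (qf, w.length + 1, []) ∧ l'.length < l.length

theorem path_pos {T : MarbleT A B} {w : List A} {c l v d} (h : Path T w c l v d) :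
    0 < l.length := by
  cases h <;> simp

theorem loc_complete {T : MarbleT A B} {w : List A} {t : ℕ} (hC : Cmp T w t)
    (ht : t ≤ w.length + 1) (π : List (T.C × ℕ)) (hπ : Above t π) (qf : T.Q) (hf : qf ∈ T.final) :
    ∀ N, ∀ l v q o, l.length ≤ N → Path T w (q, t, stk o t π) l v (qf, w.length + 1, []) →
      ∃ l0 q', Loc T (eAt T w t) (tapeAt w t) (q, o) l0 q' ∧
        (t ≤ w.length → ∃ l' v', Path T w (q', t + 1, π) l' v' (qf, w.length + 1, []) ∧
          l'.length < l.length) := by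
  intro N
  induction N with
  | zero =>
    intro l v q o hl hp
    exact absurd (path_pos hp) (by omega)
  | succ N ih =>
    intro l v q o hl hp
    have hma := marbleAt_stk o t π hπ
    by_cases hacc : tapeAt w t = TapeSym.rend ∧ q ∈ T.final ∧ o = none
    · refine ⟨[], q, .exit (by simp [locStep, hacc]), fun h => ?_⟩
      have := tapeAt_rend.1 hacc.1
      omega
    · generalize hc : (q, t, stk o t π) = c at hp
      cases hp with
      | nil =>
        simp only [Prod.mk.injEq] at hc
        obtain ⟨rfl, rfl, h3⟩ := hc
        exfalso
        apply hacc
        refine ⟨tapeAt_rend.2 le_rfl, hf, ?_⟩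
        rcases o with _ | cc
        · rfl
        · simp [stk] at h3
      | @cons _ v1 c' l1 u1 _ hs hp1 =>
        subst hc
        simp only [List.length_cons] at hl ⊢
        generalize hc : (q, t, stk o t π) = c at hs
        cases hs with
        | @L q2 m2 π2 q' _ htr h1 =>
          simp only [Prod.mk.injEq] at hc
          obtain ⟨rfl, rfl, rfl⟩ := hc
          rw [hma] at htr
          obtain ⟨q'', h2, l', v', h3, h4⟩ := hC (t - 1) (by omega) _ _ _ _ _
            (above_pred o t π hπ h1) hf hp1
          obtain ⟨l0, q3, h5, h6⟩ := ih l' v' q'' o (by omega) h3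
          refine ⟨_, q3, .cont (c' := (q'', o)) (l := v1.map Sum.inl ++ [Sum.inr (some q')]) ?_ h5, fun h => ?_⟩
          · simp [locStep, hacc, htr, h2]
          · obtain ⟨l4, v4, h7, h8⟩ := h6 h
            exact ⟨l4, v4, h7, by omega⟩
        | @R q2 m2 π2 q' _ h0 htr h1 =>
          simp only [Prod.mk.injEq] at hc
          obtain ⟨rfl, rfl, rfl⟩ := hc
          rw [hma] at h0
          subst h0
          refine ⟨v1.map Sum.inl, q', .exit ?_, fun _ => ⟨_, _, hp1, by omega⟩⟩
          have : tapeAt w t ≠ TapeSym.rend := by rw [Ne, tapeAt_rend]; omega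
          simp [locStep, htr, this]
        | @lift q2 m2 π2 q' cc _ htr =>
          simp only [Prod.mk.injEq] at hc
          obtain ⟨rfl, rfl, h3⟩ := hc
          rw [h3] at hma
          simp only [marbleAt, if_true] at hma
          subst hma
          simp only [stk, List.cons.injEq, true_and] at h3
          subst h3
          obtain ⟨l0, q3, h5, h6⟩ := ih _ _ q' none (by omega) hp1
          refine ⟨_, q3, .cont (c' := (q', none)) (l := v1.map Sum.inl) ?_ h5, fun h => ?_⟩
          · simp [locStep, htr]
          · obtain ⟨l4, v4, h7, h8⟩ := h6 h
            exact ⟨l4, v4, h7, by omega⟩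
        | @drop q2 m2 π2 q' cc _ h0 htr =>
          simp only [Prod.mk.injEq] at hc
          obtain ⟨rfl, rfl, rfl⟩ := hc
          rw [hma] at h0
          subst h0
          obtain ⟨l0, q3, h5, h6⟩ := ih _ _ q' (some cc) (by omega) hp1
          refine ⟨_, q3, .cont (c' := (q', some cc)) (l := v1.map Sum.inl) ?_ h5, fun h => ?_⟩
          · have : ¬ (tapeAt w t = TapeSym.rend ∧ q ∈ T.final) := fun h => hacc ⟨h.1, h.2, rfl⟩
            simp [locStep, this, htr]
          · obtain ⟨l4, v4, h7, h8⟩ := h6 h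
            exact ⟨l4, v4, h7, by omega⟩

theorem cmp_all {T : MarbleT A B} {w : List A} : ∀ t, t ≤ w.length + 1 → Cmp T w t
  | 0, _ => by intro m h; omega
  | t + 1, ht => by
    have ih := cmp_all (T := T) (w := w) t (by omega)
    intro m hm p π l v qf hπ hf hp
    obtain rfl : t = m := by omega
    obtain ⟨l0, q', h1, h2⟩ := loc_complete ih (by omega) π hπ qf hf _ l v p none le_rfl hp
    refine ⟨q', ?_, h2 (by omega)⟩
    simp only [eAt, nextE]
    rw [res_eq (x := some p) rfl h1]
    rfl

theorem start_complete {T : MarbleT A B} {w : List A} (qf : T.Q) (hf : qf ∈ T.final) (l : _) (v : _)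
    (hp : Path T w (T.q0, 0, []) l v (qf, w.length + 1, [])) :
    ∀ t, t ≤ w.length + 1 → ∃ q', eAt T w (t + 1) none = some q' ∧
      (t ≤ w.length → ∃ l' v', Path T w (q', t + 1, []) l' v' (qf, w.length + 1, [])) := by
  intro t
  induction t with
  | zero =>
    intro _
    obtain ⟨l0, q', h1, h2⟩ := loc_complete (cmp_all 0 (by omega)) (by omega) []
      (by intro x hx; simp at hx) qf hf _ l v T.q0 none le_rfl hp
    refine ⟨q', ?_, fun h => ?_⟩
    · show Option.map Prod.snd (res T (eAt T w 0) (tapeAt w 0) none) = some q'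
      rw [res_eq (x := none) (l0 := []) (p := T.q0) (by simp [start, tapeAt]) h1]
      rfl
    · obtain ⟨l', v', h3, _⟩ := h2 h
      exact ⟨l', v', h3⟩
  | succ t ih =>
    intro ht
    obtain ⟨q1, h1, h2⟩ := ih (by omega)
    obtain ⟨l1, v1, h3⟩ := h2 (by omega)
    obtain ⟨l0, q', h4, h5⟩ := loc_complete (cmp_all (t + 1) (by omega)) (by omega) []
      (by intro x hx; simp at hx) qf hf _ l1 v1 q1 none le_rfl h3
    refine ⟨q', ?_, fun h => ?_⟩
    · rw [eAt, nextE]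
      rw [res_eq (x := none) (l0 := [Sum.inr none]) (p := q1) (by simp [start, tapeAt_lend, h1]) h4]
      rfl
    · obtain ⟨l', v', h3, _⟩ := h5 h
      exact ⟨l', v', h3⟩

theorem start_sound {T : MarbleT A B} {w : List A} :
    ∀ t, t ≤ w.length + 1 → ∀ q, eAt T w (t + 1) none = some q →
      MarbleT.Steps T w (T.q0, 0, []) (VAt T w (t + 1) none) (q, min (t + 1) (w.length + 1), []) ∧
      (t = w.length + 1 → q ∈ T.final) := by
  intro t
  induction t with
  | zero =>
    intro _ q h
    simp only [eAt, nextE, Option.map_eq_some_iff] at h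
    obtain ⟨⟨l, q'⟩, h1, rfl⟩ := h
    obtain ⟨l0, p', l', h2, h3, rfl⟩ := res_spec h1
    simp only [start, tapeAt, if_true, Option.some.injEq, Prod.mk.injEq] at h2
    obtain ⟨rfl, rfl⟩ := h2
    have := (loc_sound (t := 0) (snd_all 0 (by omega)) (by omega) h3 []
      (by intro x hx; simp at hx))
    have e : outl T (eAt T w 0) (tapeAt w 0) none = [] ++ l' := by
      unfold outl; rw [eAt, h1]; rfl
    have hV : VAt T w (0 + 1) none = evalSubst (VAt T w 0) (outl T (eAt T w 0) (tapeAt w 0) none) := rfl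
    rw [hV, e]
    exact this
  | succ t ih =>
    intro ht q h
    rw [eAt, nextE, Option.map_eq_some_iff] at h
    obtain ⟨⟨l, q'⟩, h1, rfl⟩ := h
    obtain ⟨l0, p', l', h2, h3, rfl⟩ := res_spec h1
    simp only [start, tapeAt_lend, Nat.add_eq_zero_iff, one_ne_zero, and_false, if_false,
      Option.map_eq_some_iff, Prod.mk.injEq] at h2
    obtain ⟨q1, h4, rfl, rfl⟩ := h2
    obtain ⟨h5, -⟩ := ih (by omega) q1 h4
    rw [Nat.min_eq_left (by omega)] at h5
    have := (loc_sound (snd_all (t + 1) (by omega)) (by omega) h3 []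
      (by intro x hx; simp at hx))
    refine ⟨?_, this.2⟩
    have e : outl T (eAt T w (t + 1)) (tapeAt w (t + 1)) none = [Sum.inr none] ++ l' := by
      unfold outl; rw [h1]; rfl
    have hV : VAt T w (t + 1 + 1) none =
      evalSubst (VAt T w (t + 1)) (outl T (eAt T w (t + 1)) (tapeAt w (t + 1)) none) := rfl
    rw [hV, e, evalSubst_append, evalSubst_inr]
    exact Steps_trans h5 this.1

theorem value_eq {T : MarbleT A B} {f : List A → List B} (hT : T.Computes (fun w => some (f w)))
    (w : List A) : f w = VAt T w (w.length + 2) none := by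
  obtain ⟨q, hq, hs⟩ := (hT w (f w)).1 rfl
  obtain ⟨l, v, hp, -⟩ := exists_path hs
  obtain ⟨q', h1, -⟩ := start_complete q hq l v hp (w.length + 1) le_rfl
  obtain ⟨h2, h3⟩ := start_sound (w.length + 1) le_rfl q' h1
  rw [Nat.min_eq_right (by omega)] at h2
  have := (hT w _).2 ⟨q', h3 rfl, h2⟩
  simpa using this

/-! ### The HDT0L system -/

def expd (T : MarbleT A B) (o : Option T.Q → List (B ⊕ Option T.Q)) :
    B ⊕ Option T.Q → List (B ⊕ Option T.Q)
  | Sum.inl b => [Sum.inl b]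
  | Sum.inr x => o x

abbrev Rg (T : MarbleT A B) : Type := (Option T.Q → Option T.Q) × (B ⊕ Option T.Q)

open Classical in
noncomputable def allE (T : MarbleT A B) : List (Option T.Q → Option T.Q) :=
  Finset.univ.toList

theorem mem_allE (T : MarbleT A B) (e) : e ∈ allE T := by simp [allE]

theorem nodup_allE (T : MarbleT A B) : (allE T).Nodup := Finset.nodup_toList _

open Classical in
noncomputable def updS (T : MarbleT A B) (s : TapeSym A) (z : Rg T) : List (Rg T) :=
  ((allE T).filter
    (fun e => nextE T e s = z.1)).flatMap
      (fun e => (expd T (outl T e s) z.2).map (fun y => (e, y)))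

def uval {X : Type} (V : X → List B) : B ⊕ X → List B
  | Sum.inl b => [b]
  | Sum.inr x => V x

open Classical in
noncomputable def U (T : MarbleT A B) (e : Option T.Q → Option T.Q) (V : Option T.Q → List B)
    (z : Rg T) : List B := if z.1 = e then uval V z.2 else []

theorem flatMap_single {α β : Type} (l : List α) (a : α) (hn : l.Nodup) (ha : a ∈ l)
    (g : α → List β) (hg : ∀ b ∈ l, b ≠ a → g b = []) : l.flatMap g = g a := by
  induction l with
  | nil => simp at ha
  | cons c l ih =>
    rw [List.nodup_cons] at hn
    rw [List.flatMap_cons]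
    by_cases hc : c = a
    · subst hc
      have : l.flatMap g = [] := by
        rw [List.flatMap_eq_nil_iff]
        intro x hx
        exact hg x (List.mem_cons_of_mem _ hx) (fun h => hn.1 (h ▸ hx))
      simp [this]
    · rw [hg c (by simp) hc, List.nil_append]
      refine ih hn.2 ?_ (fun b hb => hg b (List.mem_cons_of_mem _ hb))
      rcases List.mem_cons.1 ha with h | h
      · exact absurd h.symm hc
      · exact h

theorem uval_flatMap {X : Type} (V : X → List B) (l : List (B ⊕ X)) :
    l.flatMap (uval V) = evalSubst V l := by
  unfold evalSubst
  congr 1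

theorem U_step (T : MarbleT A B) (w : List A) (t : ℕ) (z : Rg T) :
    U T (eAt T w (t + 1)) (VAt T w (t + 1)) z =
      (updS T (tapeAt w t) z).flatMap (U T (eAt T w t) (VAt T w t)) := by
  classical
  obtain ⟨e', y⟩ := z
  rw [updS, List.flatMap_assoc]
  have key : ∀ e, ((expd T (outl T e (tapeAt w t)) y).map (fun y => (e, y))).flatMap
      (U T (eAt T w t) (VAt T w t)) =
      if e = eAt T w t then evalSubst (VAt T w t) (expd T (outl T e (tapeAt w t)) y) else [] := by
    intro e
    rw [List.flatMap_map]
    by_cases he : e = eAt T w t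
    · simp only [U, he, if_true]
      exact uval_flatMap _ _
    · simp [U, he]
  simp only [key]
  by_cases he : e' = eAt T w (t + 1)
  · rw [flatMap_single _ (eAt T w t)]
    · simp only [U, he, if_true]
      cases y with
      | inl b => simp [uval, expd, evalSubst]
      | inr x => rfl
    · exact (nodup_allE T).filter _
    · simp [he, eAt, mem_allE]
    · intro b _ hb
      rw [if_neg hb]
  · rw [U, if_neg he]
    symm
    rw [List.flatMap_eq_nil_iff]
    intro e hm
    simp only [List.mem_filter, decide_eq_true_eq] at hm
    rw [if_neg]
    rintro rfl
    exact he hm.2.symm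

theorem toSys [Finite B] (T : MarbleT A B) (f : List A → List B)
    (hT : T.Computes (fun w => some (f w))) :
    ∃ (X : Type) (_ : Finite X) (upd : A → X → List X) (init : X → List B) (out : List X),
      ∀ w, f w = out.flatMap (hval upd init w.reverse) := by
  refine ⟨Rg T, inferInstance, fun a => updS T (.letter a),
    fun z => (updS T .lend z).flatMap (U T (fun _ => none) (fun _ => [])),
    ((allE T).map
      (fun e => ((e, Sum.inr none) : Rg T))).flatMap (updS T .rend), fun w => ?_⟩
  have h1 : ∀ t, t ≤ w.length → U T (eAt T w (t + 1)) (VAt T w (t + 1)) =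
      hval (fun a => updS T (.letter a))
        (fun z => (updS T .lend z).flatMap (U T (fun _ => none) (fun _ => []))) (w.take t).reverse := by
    intro t
    induction t with
    | zero =>
      intro _
      funext z
      rw [U_step]
      simp [hval, tapeAt, eAt]
      rfl
    | succ t ih =>
      intro ht
      funext z
      rw [U_step, ih (by omega), tapeAt_letter (by omega)]
      have e : (w.take (t + 1)).reverse = w[t] :: (w.take t).reverse := by
        rw [List.take_succ_eq_append_getElem (by omega), List.reverse_append]
        rfl
      rw [e]
      rfl
  have h2 := h1 w.length le_rfl
  rw [List.take_length] at h2
  rw [← h2, List.flatMap_assoc, List.flatMap_map]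
  have h3 : ∀ e, (updS T .rend (e, Sum.inr none)).flatMap
      (U T (eAt T w (w.length + 1)) (VAt T w (w.length + 1))) =
      U T (eAt T w (w.length + 2)) (VAt T w (w.length + 2)) (e, Sum.inr none) := by
    intro e
    rw [U_step, tapeAt_rend.2 le_rfl]
  simp only [h3]
  rw [flatMap_single _ (eAt T w (w.length + 2)) (nodup_allE T) (mem_allE T _)]
  · simp [U, uval]
    exact value_eq hT w
  · intro b _ hb
    simp [U, hb]

end PartB


/-! ## Part C : layers and boundedness of an HDT0L system -/

namespace PartC

variable {A B X : Type}

/-- The word of registers obtained from `x` by expanding along `r`. -/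
def W (upd : A → X → List X) : List A → X → List X
  | [] => fun x => [x]
  | a :: r => fun x => (upd a x).flatMap (W upd r)

theorem W_append (upd : A → X → List X) (r r' : List A) (x : X) :
    W upd (r ++ r') x = (W upd r x).flatMap (W upd r') := by
  induction r generalizing x with
  | nil => simp [W]
  | cons a r ih =>
    have : W upd (r ++ r') = fun x => (W upd r x).flatMap (W upd r') := funext ih
    simp [W, this, List.flatMap_assoc]

theorem hval_append (upd : A → X → List X) (init : X → List B) (r p : List A) (x : X) :
    hval upd init (r ++ p) x = (W upd r x).flatMap (hval upd init p) := by
  induction r generalizing x with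
  | nil => simp [W]
  | cons a r ih =>
    have : hval upd init (r ++ p) = fun x => (W upd r x).flatMap (hval upd init p) := funext ih
    simp [W, hval, this, List.flatMap_assoc]

theorem mem_W_append {upd : A → X → List X} {r r' : List A} {x y z : X}
    (h1 : y ∈ W upd r x) (h2 : z ∈ W upd r' y) : z ∈ W upd (r ++ r') x := by
  rw [W_append, List.mem_flatMap]
  exact ⟨y, h1, h2⟩

def seg (r : List A) (s t : ℕ) : List A := (r.take t).drop s

theorem seg_append (r : List A) {s t u : ℕ} (h1 : s ≤ t) (h2 : t ≤ u) :
    seg r s t ++ seg r t u = seg r s u := by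
  unfold seg
  have e1 : (r.take u).drop s = ((r.take u).drop s).take (t - s) ++ ((r.take u).drop s).drop (t - s) :=
    (List.take_append_drop _ _).symm
  rw [e1, List.drop_drop, List.take_drop, List.take_take]
  congr 3
  · rw [show s + (t - s) = t by omega, Nat.min_eq_left h2]
  · omega

theorem seg_succ (r : List A) (s t : ℕ) (h : s < t) (hs : s < r.length) :
    seg r s t = r[s] :: seg r (s + 1) t := by
  unfold seg
  rw [List.drop_eq_getElem_cons (by simp; omega)]
  simp

theorem seg_self (r : List A) (s : ℕ) : seg r s s = [] := by
  unfold seg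
  simp

theorem path_of_mem (upd : A → X → List X) (r : List A) (x y : X) (h : y ∈ W upd r x) :
    ∃ π : ℕ → X, π 0 = x ∧ π r.length = y ∧
      ∀ s t, s ≤ t → t ≤ r.length → π t ∈ W upd (seg r s t) (π s) := by
  induction r generalizing x with
  | nil =>
    refine ⟨fun _ => x, rfl, ?_, ?_⟩
    · simp [W] at h; exact h.symm
    · intro s t _ _; simp [seg, W]
  | cons a r ih =>
    simp only [W, List.mem_flatMap] at h
    obtain ⟨y', h1, h2⟩ := h
    obtain ⟨π, h3, h4, h5⟩ := ih y' h2
    refine ⟨fun n => match n with | 0 => x | n + 1 => π n, rfl, h4, ?_⟩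
    intro s t hst ht
    rcases t with _ | t
    · obtain rfl : s = 0 := by omega
      simp [seg, W]
    · rcases s with _ | s
      · have := h5 0 t (by omega) (by simpa using ht)
        rw [h3] at this
        simp only [seg, List.take_succ_cons, List.drop_zero, W, List.mem_flatMap]
        exact ⟨y', h1, by simpa [seg] using this⟩
      · exact h5 s t (by omega) (by simpa using ht)

theorem count_flatMap_ge [DecidableEq X] (l : List X) (g : X → List X) (z y : X) :
    l.count z * (g z).count y ≤ (l.flatMap g).count y := by
  induction l with
  | nil => simp
  | cons c l ih =>
    rw [List.flatMap_cons, List.count_append, List.count_cons]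
    by_cases hc : c = z
    · subst hc; simp; nlinarith
    · simp [hc]; omega

theorem count_flatMap_ge2 [DecidableEq X] (l : List X) (g : X → List X) (z z' y : X) (hz : z ∈ l)
    (hz' : z' ∈ l) (hne : z ≠ z') :
    (g z).count y + (g z').count y ≤ (l.flatMap g).count y := by
  have key : ∀ l : List X, l.count z * (g z).count y + l.count z' * (g z').count y ≤
      (l.flatMap g).count y := by
    intro l
    induction l with
    | nil => simp
    | cons c l ih =>
      rw [List.flatMap_cons, List.count_append, List.count_cons, List.count_cons]
      by_cases hc : c = z
      · subst hc; simp [hne]; nlinarith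
      · by_cases hc' : c = z'
        · subst hc'; simp [hne.symm]; nlinarith
        · simp [hc, hc']; omega
  have h1 := List.count_pos_iff.2 hz
  have h2 := List.count_pos_iff.2 hz'
  have := key l
  nlinarith

/-! ### Ramsey -/

theorem pigeon_list {Col : Type} [Fintype Col] (g : ℕ → Col) (l : List ℕ) (m : ℕ)
    (h : Fintype.card Col * m + 1 ≤ l.length) :
    ∃ c : Col, ∃ l' : List ℕ, l'.Sublist l ∧ l'.length = m ∧ ∀ t ∈ l', g t = c := by
  classical
  have h1 : ∃ c : Col, m ≤ (l.filter (fun t => g t = c)).length := by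
    by_contra hcon
    push Not at hcon
    have h2 : ∀ l : List ℕ, l.length = ∑ c : Col, (l.filter (fun t => g t = c)).length := by
      intro l
      induction l with
      | nil => simp
      | cons a l ih =>
        have : ∀ c : Col, ((a :: l).filter (fun t => g t = c)).length =
          (l.filter (fun t => g t = c)).length + if g a = c then 1 else 0 := by
          intro c
          by_cases hc : g a = c <;> simp [hc]
        simp only [this, Finset.sum_add_distrib, ← ih]
        simp
    have h3 : l.length ≤ ∑ c : Col, m := by
      rw [h2 l]
      exact Finset.sum_le_sum fun c _ => (hcon c).le
    simp at h3
    omega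
  obtain ⟨c, hc⟩ := h1
  refine ⟨c, (l.filter (fun t => g t = c)).take m, (List.take_sublist _ _).trans List.filter_sublist,
    by simp; exact hc, ?_⟩
  intro t ht
  have := List.mem_of_mem_take ht
  simpa using (List.mem_filter.1 this).2

theorem ramsey_min {Col : Type} [Fintype Col] (j : ℕ) : ∃ N, ∀ (c : ℕ → ℕ → Col) (l : List ℕ),
    l.Pairwise (· < ·) → N ≤ l.length → ∃ l' : List ℕ, l'.Sublist l ∧ l'.length = j ∧
      ∃ g : ℕ → Col, l'.Pairwise (fun s t => c s t = g s) := by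
  classical
  induction j with
  | zero => exact ⟨0, fun c l _ h => ⟨[], by simp, rfl, fun _ => c 0 0, by simp⟩⟩
  | succ j ih =>
    obtain ⟨N, hN⟩ := ih
    refine ⟨Fintype.card Col * N + 2, fun c l hl h => ?_⟩
    rcases l with _ | ⟨t, l⟩
    · simp at h
    · obtain ⟨c0, l1, h1, h2, h3⟩ := pigeon_list (c t) l N (by simp at h; omega)
      rw [List.pairwise_cons] at hl
      obtain ⟨l2, h4, h5, g, h6⟩ := hN c l1 (hl.2.sublist h1) h2.ge
      refine ⟨t :: l2, List.Sublist.cons_cons _ (h4.trans h1), by simp [h5],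
        fun s => if s = t then c0 else g s, ?_⟩
      rw [List.pairwise_cons]
      refine ⟨fun u hu => by simp [h3 u (h4.subset hu)], ?_⟩
      refine h6.imp_of_mem ?_
      intro a b ha hb hab
      have : t < a := hl.1 a (h1.subset (h4.subset ha))
      show c a b = if a = t then c0 else g a
      rw [if_neg (by omega)]
      exact hab

theorem ramsey {Col : Type} [Finite Col] (m : ℕ) : ∃ N, ∀ (c : ℕ → ℕ → Col) (l : List ℕ),
    l.Pairwise (· < ·) → N ≤ l.length → ∃ s : ℕ → ℕ, ∃ e : Col, (∀ i < m, s i ∈ l) ∧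
      (∀ i j, i < j → j < m → s i < s j ∧ c (s i) (s j) = e) := by
  classical
  have := Fintype.ofFinite Col
  obtain ⟨N, hN⟩ := ramsey_min (Col := Col) (Fintype.card Col * m + 1)
  refine ⟨N, fun c l hl h => ?_⟩
  obtain ⟨l1, h1, h2, g, h3⟩ := hN c l hl h
  obtain ⟨e, l2, h4, h5, h6⟩ := pigeon_list g l1 m h2.ge
  refine ⟨fun i => l2.getD i 0, e, ?_, ?_⟩
  · intro i hi
    have hi' : i < l2.length := by omega
    show l2.getD i 0 ∈ l
    rw [List.getD_eq_getElem _ _ hi']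
    exact h1.subset (h4.subset (List.getElem_mem _))
  · intro i j hij hj
    have hj' : j < l2.length := by omega
    have hi' : i < l2.length := by omega
    simp only
    rw [List.getD_eq_getElem _ _ hi', List.getD_eq_getElem _ _ hj']
    have h7 := List.pairwise_iff_getElem.1 (hl.sublist (h4.trans h1)) i j hi' hj' hij
    have h8 := List.pairwise_iff_getElem.1 (h3.sublist h4) i j hi' hj' hij
    exact ⟨h7, h8.trans (h6 _ (List.getElem_mem _))⟩

theorem pigeon_fun [Fintype X] (φ : ℕ → X) : ∃ i j, i < j ∧ j ≤ Fintype.card X ∧ φ i = φ j := by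
  classical
  obtain ⟨i, hi, j, hj, hne, he⟩ := Finset.exists_ne_map_eq_of_card_lt_of_maps_to
    (s := Finset.range (Fintype.card X + 1)) (t := (Finset.univ : Finset X)) (f := φ)
    (by simp) (fun _ _ => Finset.mem_univ _)
  simp only [Finset.mem_range] at hi hj
  rcases lt_or_gt_of_ne hne with h | h
  · exact ⟨i, j, h, by omega, he⟩
  · exact ⟨j, i, h, by omega, he.symm⟩

/-! ### Boundedness -/

def live (upd : A → X → List X) (r : List A) (t : ℕ) (z : X) : Prop := W upd (r.drop t) z ≠ []

def Branch (upd : A → X → List X) (r : List A) (x : X) (t : ℕ) : Prop :=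
  ∃ h : t < r.length, ∃ z ∈ W upd (r.take t) x, ∃ y1 y2,
    List.Sublist [y1, y2] (upd r[t] z) ∧ live upd r (t + 1) y1 ∧ live upd r (t + 1) y2

theorem flatMap_length_le {Y : Type} (l : List X) (p : X → Bool) (g : X → List Y) (c : ℕ)
    (h1 : ∀ z ∈ l, p z = false → g z = []) (h2 : ∀ z ∈ l, p z = true → (g z).length ≤ c) :
    (l.flatMap g).length ≤ (l.filter p).length * c := by
  induction l with
  | nil => simp
  | cons a l ih =>
    have ih := ih (fun z hz => h1 z (by simp [hz])) (fun z hz => h2 z (by simp [hz]))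
    rw [List.flatMap_cons, List.length_append]
    rcases hp : p a with _ | _
    · rw [h1 a (by simp) hp]; simpa [List.filter_cons, hp] using ih
    · have := h2 a (by simp) hp
      simp only [List.filter_cons, hp, if_true, List.length_cons]
      nlinarith

open Classical in
theorem length_le_branch (upd : A → X → List X) (M : ℕ)
    (hM : ∀ a x, (upd a x).length ≤ M) (r : List A) (x : X) :
    ∀ t, t ≤ r.length → ((W upd (r.take t) x).filter (fun z => live upd r t z)).length ≤
      M ^ (((List.range t).filter (fun t => Branch upd r x t)).length) := by
  intro t
  induction t with
  | zero =>
    intro _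
    simp only [List.take_zero, W, List.range_zero, List.filter_nil, List.length_nil, pow_zero]
    exact (List.length_filter_le _ _)
  | succ t ih =>
    intro ht
    have ih := ih (by omega)
    have e1 : W upd (r.take (t + 1)) x = (W upd (r.take t) x).flatMap (upd r[t]) := by
      rw [List.take_succ_eq_append_getElem (by omega), W_append]
      congr 1
      funext z
      simp [W]
    have hlive : ∀ z, ¬ live upd r t z → ∀ y ∈ upd r[t] z, ¬ live upd r (t + 1) y := by
      intro z hz y hy hl
      apply hz
      unfold live at hl ⊢
      rw [List.drop_eq_getElem_cons (by omega)]
      simp only [W, ne_eq, List.flatMap_eq_nil_iff, not_forall]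
      exact ⟨y, hy, hl⟩
    rw [e1, List.filter_flatMap, List.range_succ, List.filter_append, List.length_append, pow_add]
    by_cases hb : Branch upd r x t
    · refine (flatMap_length_le _ (fun z => live upd r t z) _ M ?_ ?_).trans
        (Nat.mul_le_mul ih (by simp [hb]))
      · intro z hz hp
        rw [List.filter_eq_nil_iff]
        intro y hy
        simpa using hlive z (by simpa using hp) y hy
      · intro z hz hp
        exact (List.length_filter_le _ _).trans (hM _ _)
    · refine (flatMap_length_le _ (fun z => live upd r t z) _ 1 ?_ ?_).trans
        (Nat.mul_le_mul ih (by simp [hb]))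
      · intro z hz hp
        rw [List.filter_eq_nil_iff]
        intro y hy
        simpa using hlive z (by simpa using hp) y hy
      · intro z hz hp
        by_contra hlen
        apply hb
        have h2 : 2 ≤ ((upd r[t] z).filter (fun z => live upd r (t + 1) z)).length := by omega
        rcases hl : (upd r[t] z).filter (fun z => live upd r (t + 1) z) with _ | ⟨y1, _ | ⟨y2, l⟩⟩
        · rw [hl] at h2; simp at h2
        · rw [hl] at h2; simp at h2
        have hy1 : y1 ∈ (upd r[t] z).filter (fun z => live upd r (t + 1) z) := by rw [hl]; simp
        have hy2 : y2 ∈ (upd r[t] z).filter (fun z => live upd r (t + 1) z) := by rw [hl]; simp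
        refine ⟨by omega, z, hz, y1, y2, ?_, by simpa using (List.mem_filter.1 hy1).2,
          by simpa using (List.mem_filter.1 hy2).2⟩
        refine List.Sublist.trans ?_ (List.filter_sublist (p := fun z => live upd r (t + 1) z))
        rw [hl]
        simp

/-- Continuation of a live node. -/
theorem live_path (upd : A → X → List X) (r : List A) (t : ℕ) (y : X) (hl : live upd r t y)
    (ht : t ≤ r.length) : ∃ ρ : ℕ → X, ρ t = y ∧
      ∀ s u, t ≤ s → s ≤ u → u ≤ r.length → ρ u ∈ W upd (seg r s u) (ρ s) := by
  unfold live at hl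
  obtain ⟨z, hz⟩ := List.exists_mem_of_ne_nil _ hl
  obtain ⟨π, h1, h2, h3⟩ := path_of_mem upd _ _ _ hz
  refine ⟨fun n => π (n - t), by simp [h1], ?_⟩
  intro s u h4 h5 h6
  have := h3 (s - t) (u - t) (by omega) (by simp; omega)
  have e : seg (r.drop t) (s - t) (u - t) = seg r s u := by
    unfold seg
    rw [List.take_drop, List.drop_drop]
    congr 1
    · omega
    · congr 1; omega
  rwa [e] at this

open Classical in
theorem bounded [Finite A] [Finite X] (upd : A → X → List X)
    (heavy : ∀ v x, (W upd v x).count x ≤ 1)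
    (barbell : ∀ v x y, x ∈ W upd v x → y ∈ W upd v x → y ∈ W upd v y → y = x) :
    ∃ K, ∀ r x, (W upd r x).length ≤ K := by
  have := Fintype.ofFinite X
  obtain ⟨M0, hM0⟩ := PartA.exists_bound (fun p : A × X => (upd p.1 p.2).length)
  set n := Fintype.card X with hn
  obtain ⟨N, hN⟩ := ramsey (Col := X → X → Prop) (2 * n + 4)
  refine ⟨(M0 + 1) ^ N, fun r x => ?_⟩
  have h1 := length_le_branch upd (M0 + 1) (fun a x => (hM0 (a, x)).trans (by omega)) r x
    r.length le_rfl
  have h2 : (W upd (r.take r.length) x).filter (fun z => live upd r r.length z) = W upd r x := by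
    rw [List.take_length, List.filter_eq_self]
    intro z _
    simp [live, W]
  rw [h2] at h1
  refine h1.trans (Nat.pow_le_pow_right (by omega) ?_)
  by_contra hcon
  obtain ⟨s, e, hs1, hs2⟩ := hN (fun i j => fun z z' => z' ∈ W upd (seg r i j) z) _
    ((List.pairwise_lt_range (n := r.length)).filter (fun t => Branch upd r x t)) (by omega)
  have hs3 : ∀ i j, i < j → j < 2 * n + 4 → ∀ z z', e z z' ↔ z' ∈ W upd (seg r (s i) (s j)) z := by
    intro i j hij hj z z'
    rw [← (hs2 i j hij hj).2]
  have hs0 : ∀ i j, i < j → j < 2 * n + 4 → s i < s j := fun i j h h' => (hs2 i j h h').1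
  have hsl : ∀ i, i < 2 * n + 4 → s i < r.length := by
    intro i hi
    have := hs1 i hi
    simp only [List.mem_filter, List.mem_range] at this
    exact this.1
  have hbr : Branch upd r x (s (n + 1)) := by
    have := hs1 (n + 1) (by omega)
    simpa using (List.mem_filter.1 this).2
  obtain ⟨hlt, y, hy, y1, y2, hsub, hl1, hl2⟩ := hbr
  -- transitivity of `e`
  have etrans : ∀ a b c, e a b → e b c → e a c := by
    intro a b c h1 h2
    rw [hs3 0 1 (by omega) (by omega)] at h1
    rw [hs3 1 2 (by omega) (by omega)] at h2
    rw [hs3 0 2 (by omega) (by omega), ← seg_append r (hs0 0 1 (by omega) (by omega)).le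
      (hs0 1 2 (by omega) (by omega)).le]
    exact mem_W_append h1 h2
  obtain ⟨π, hπ0, hπ1, hπ2⟩ := path_of_mem upd _ _ _ hy
  have hlen : (r.take (s (n + 1))).length = s (n + 1) := by simp; omega
  rw [hlen] at hπ1 hπ2
  have hπ3 : ∀ i j, i < j → j ≤ n + 1 → e (π (s i)) (π (s j)) := by
    intro i j hij hj
    have h5 : s j ≤ s (n + 1) := by
      rcases Nat.lt_or_ge j (n + 1) with h | h
      · exact (hs0 _ _ h (by omega)).le
      · rw [show j = n + 1 by omega]
    have := hπ2 (s i) (s j) (hs0 i j hij (by omega)).le h5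
    rw [hs3 i j hij (by omega)]
    have e2 : seg (r.take (s (n + 1))) (s i) (s j) = seg r (s i) (s j) := by
      unfold seg
      rw [List.take_take, Nat.min_eq_left h5]
    rwa [e2] at this
  obtain ⟨b, b', hb, hb', hbb⟩ := pigeon_fun (fun i => π (s i))
  set z := π (s b) with hz
  have hzz : e z z := by
    have := hπ3 b b' hb (by omega)
    rwa [← hz, ← hbb] at this
  have hzy : e z y := by
    have := hπ3 b (n + 1) (by omega) le_rfl
    rwa [hπ1] at this
  -- every live child reaches `z` at the last time
  have child : ∀ y', y' ∈ upd r[s (n + 1)] y → live upd r (s (n + 1) + 1) y' →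
      z ∈ W upd (seg r (s (n + 1) + 1) (s (2 * n + 3))) y' := by
    intro y' hy' hl'
    obtain ⟨ρ, hρ0, hρ⟩ := live_path upd r _ y' hl' (by omega)
    have hge : ∀ i, n + 2 ≤ i → i < 2 * n + 4 → s (n + 1) + 1 ≤ s i := by
      intro i hi hi'
      exact hs0 (n + 1) i (by omega) hi'
    have hρ1 : ∀ i j, n + 2 ≤ i → i < j → j < 2 * n + 4 → e (ρ (s i)) (ρ (s j)) := by
      intro i j hi hij hj
      rw [hs3 i j hij hj]
      exact hρ _ _ (hge i hi (by omega)) (hs0 i j hij hj).le (hsl j hj).le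
    have hρ2 : ∀ i, n + 2 ≤ i → i < 2 * n + 4 → e y (ρ (s i)) := by
      intro i hi hi'
      rw [hs3 (n + 1) i (by omega) hi', seg_succ r _ _ (hge i hi hi') hlt]
      simp only [W, List.mem_flatMap]
      refine ⟨y', hy', ?_⟩
      have := hρ _ (s i) le_rfl (hge i hi hi') (hsl i hi').le
      rwa [hρ0] at this
    obtain ⟨c, c', hc, hc', hcc⟩ := pigeon_fun (fun i => ρ (s (n + 2 + i)))
    have hz' : ρ (s (n + 2 + c)) = z := by
      have h5 : e (ρ (s (n + 2 + c))) (ρ (s (n + 2 + c))) := by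
        have := hρ1 (n + 2 + c) (n + 2 + c') (by omega) (by omega) (by omega)
        rwa [← hcc] at this
      have h6 : e z (ρ (s (n + 2 + c))) := etrans _ _ _ hzy (hρ2 _ (by omega) (by omega))
      refine barbell (seg r (s 0) (s 1)) z _ ?_ ?_ ?_
      · exact (hs3 0 1 (by omega) (by omega) _ _).1 hzz
      · exact (hs3 0 1 (by omega) (by omega) _ _).1 h6
      · exact (hs3 0 1 (by omega) (by omega) _ _).1 h5
    have h7 := hρ _ (s (n + 2 + c)) le_rfl (hge _ (by omega) (by omega)) (hsl _ (by omega)).le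
    rw [hρ0, hz'] at h7
    have hlast : n + 2 + c < 2 * n + 3 := by omega
    rw [← seg_append r (hge (n + 2 + c) (by omega) (by omega)) (hs0 _ _ hlast (by omega)).le]
    exact mem_W_append h7 ((hs3 _ _ hlast (by omega) _ _).1 hzz)
  have c1 := child y1 (hsub.subset (by simp)) hl1
  have c2 := child y2 (hsub.subset (by simp)) hl2
  have h8 : 2 ≤ (W upd (seg r (s (n + 1)) (s (2 * n + 3))) y).count z := by
    rw [seg_succ r _ _ (hs0 _ _ (by omega) (by omega)) hlt]
    simp only [W]
    have h9 := (hsub.flatMap (W upd (seg r (s (n + 1) + 1) (s (2 * n + 3))))).count_le z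
    simp only [List.flatMap_cons, List.flatMap_nil, List.count_append, List.count_nil] at h9
    have := List.count_pos_iff.2 c1
    have := List.count_pos_iff.2 c2
    omega
  have h10 := count_flatMap_ge (W upd (seg r (s b) (s (n + 1))) z)
    (W upd (seg r (s (n + 1)) (s (2 * n + 3)))) y z
  have h11 := List.count_pos_iff.2 ((hs3 b (n + 1) (by omega) (by omega) _ _).1 hzy)
  rw [← W_append] at h10
  have h12 := heavy (seg r (s b) (s (n + 1)) ++ seg r (s (n + 1)) (s (2 * n + 3))) z
  nlinarith

end PartC


namespace PartC

variable {A B X : Type}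

/-- Polynomial boundedness of the expansion of `x`. -/
def Pb (upd : A → X → List X) (d : ℕ) (x : X) : Prop :=
  ∃ C, ∀ r, (W upd r x).length ≤ C * r.length ^ d + C

/-- The layer of a register. -/
noncomputable def lay (upd : A → X → List X) (x : X) : ℕ := sInf {d | Pb upd d x}

theorem length_le_flatMap {Y Z : Type} {l : List Y} {y : Y} (h : y ∈ l) (g : Y → List Z) :
    (g y).length ≤ (l.flatMap g).length := by
  induction l with
  | nil => simp at h
  | cons c l ih =>
    rw [List.flatMap_cons, List.length_append]
    rcases List.mem_cons.1 h with h | h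
    · subst h; omega
    · have := ih h; omega

theorem Pb_child {upd : A → X → List X} {d : ℕ} {x y : X} {a : A} (h : Pb upd d x)
    (hy : y ∈ upd a x) : Pb upd d y := by
  obtain ⟨C, hC⟩ := h
  refine ⟨C * 2 ^ d + C, fun r => ?_⟩
  have h1 := hC (a :: r)
  have h2 := length_le_flatMap hy (W upd r)
  have h3 := PartA.poly_shift 1 d r.length
  simp only [W, List.length_cons] at h1
  have h4 : C * (r.length + 1) ^ d ≤ C * (2 ^ d * r.length ^ d + 2 ^ d) := Nat.mul_le_mul_left _ h3
  nlinarith [Nat.zero_le (C * r.length ^ d)]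

theorem lay_spec {upd : A → X → List X} {d : ℕ} {x : X} (h : Pb upd d x) :
    Pb upd (lay upd x) x ∧ lay upd x ≤ d :=
  ⟨Nat.sInf_mem (s := {d | Pb upd d x}) ⟨d, h⟩, Nat.sInf_le h⟩

def rep (v : List A) : ℕ → List A
  | 0 => []
  | j + 1 => v ++ rep v j

theorem rep_length (v : List A) (j : ℕ) : (rep v j).length = j * v.length := by
  induction j with
  | zero => simp [rep]
  | succ j ih => simp [rep, ih]; ring

theorem count_mul_le [DecidableEq X] {Z : Type} (l : List X) (g : X → List Z) (y : X) :
    l.count y * (g y).length ≤ (l.flatMap g).length := by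
  induction l with
  | nil => simp
  | cons c l ih =>
    rw [List.flatMap_cons, List.length_append, List.count_cons]
    generalize (l.flatMap g).length = N at *
    by_cases hc : c = y
    · subst hc; simp; nlinarith
    · simp [hc]; omega

theorem pump [DecidableEq X] {upd : A → X → List X} {k : ℕ} (hP : ∀ x, Pb upd k x) {x y : X}
    {v : List A} (h : ∀ j, j ≤ (W upd (rep v j) x).count y) : lay upd y < lay upd x := by
  obtain ⟨C, hC⟩ := (lay_spec (hP x)).1
  rcases hd : lay upd x with _ | d
  · exfalso
    have h1 := h (2 * C + 1)
    have h2 := hC (rep v (2 * C + 1))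
    have h3 := List.count_le_length (a := y) (l := W upd (rep v (2 * C + 1)) x)
    rw [hd, pow_zero] at h2
    omega
  · rw [hd] at hC
    refine Nat.lt_succ_of_le (lay_spec ?_).2
    set D := C * (v.length + 1) ^ (d + 1) + C with hD
    refine ⟨D * 2 ^ d, fun r => ?_⟩
    have h1 := h (r.length + 1)
    have h2 := hC (rep v (r.length + 1) ++ r)
    rw [W_append] at h2
    have h3 := count_mul_le (W upd (rep v (r.length + 1)) x) (W upd r) y
    have h4 : (r.length + 1) * (W upd r y).length ≤ (r.length + 1) * (D * (r.length + 1) ^ d) := by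
      calc (r.length + 1) * (W upd r y).length
          ≤ (W upd (rep v (r.length + 1)) x).count y * (W upd r y).length :=
            Nat.mul_le_mul_right _ h1
        _ ≤ C * ((r.length + 1) * v.length + r.length) ^ (d + 1) + C := by
            refine h3.trans (h2.trans ?_)
            rw [List.length_append, rep_length]
        _ ≤ C * ((r.length + 1) * (v.length + 1)) ^ (d + 1) + C * (r.length + 1) ^ (d + 1) := by
            refine Nat.add_le_add (Nat.mul_le_mul_left _ (Nat.pow_le_pow_left ?_ _)) ?_
            · nlinarith
            · exact Nat.le_mul_of_pos_right _ (by positivity)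
        _ = (r.length + 1) * (D * (r.length + 1) ^ d) := by
            rw [hD, mul_pow]; ring
    have h5 := Nat.le_of_mul_le_mul_left h4 (by omega)
    have h6 := Nat.mul_le_mul_left D (PartA.poly_shift 1 d r.length)
    calc _ ≤ _ := h5
      _ ≤ _ := h6
      _ = _ := by ring

theorem no_heavy [DecidableEq X] {upd : A → X → List X} {k : ℕ} (hP : ∀ x, Pb upd k x)
    (v : List A) (x : X) : (W upd v x).count x ≤ 1 := by
  by_contra hcon
  refine absurd (pump hP (x := x) (y := x) (v := v) (fun j => ?_)) (lt_irrefl _)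
  have : 2 ^ j ≤ (W upd (rep v j) x).count x := by
    induction j with
    | zero => simp [rep, W]
    | succ j ih =>
      rw [rep, W_append]
      have := count_flatMap_ge (W upd v x) (W upd (rep v j)) x x
      rw [pow_succ]
      nlinarith
  exact (Nat.lt_two_pow_self).le.trans this

theorem no_barbell [DecidableEq X] {upd : A → X → List X} {k : ℕ} (hP : ∀ x, Pb upd k x)
    (v : List A) (x y : X) (h1 : x ∈ W upd v x) (h2 : y ∈ W upd v x) (h3 : y ∈ W upd v y)
    (hne : y ≠ x) : lay upd y < lay upd x := by
  have hy : ∀ j, 1 ≤ (W upd (rep v j) y).count y := by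
    intro j
    induction j with
    | zero => simp [rep, W]
    | succ j ih =>
      rw [rep, W_append]
      have := count_flatMap_ge (W upd v y) (W upd (rep v j)) y y
      have := List.count_pos_iff.2 h3
      nlinarith
  refine pump hP (v := v) (fun j => ?_)
  induction j with
  | zero => simp
  | succ j ih =>
    rw [rep, W_append]
    have := count_flatMap_ge2 (W upd v x) (W upd (rep v j)) x y y h1 h2 hne.symm
    have := hy j
    omega

open Classical in
/-- Restriction of the system to children of the same layer. -/
noncomputable def sameL (upd : A → X → List X) (L : X → ℕ) (a : A) (x : X) : List X :=
  (upd a x).filter (fun y => L y = L x)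

theorem sameL_sublist (upd : A → X → List X) (L : X → ℕ) (r : List A) (x : X) :
    (W (sameL upd L) r x).Sublist (W upd r x) := by
  induction r generalizing x with
  | nil => simp [W]
  | cons a r ih =>
    simp only [W]
    refine List.Sublist.trans (List.Sublist.flatMap_right _ (fun y _ => ih y)) ?_
    exact List.Sublist.flatMap List.filter_sublist _

theorem sameL_lay (upd : A → X → List X) (L : X → ℕ) (r : List A) (x y : X)
    (h : y ∈ W (sameL upd L) r x) : L y = L x := by
  induction r generalizing x with
  | nil => simp [W] at h; rw [h]
  | cons a r ih =>
    simp only [W, List.mem_flatMap, sameL, List.mem_filter, decide_eq_true_eq] at h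
    obtain ⟨z, h1, h2⟩ := h
    rw [ih z h2, h1.2]

theorem sameL_bounded [Finite A] [Finite X] {upd : A → X → List X} {k : ℕ}
    (hP : ∀ x, Pb upd k x) : ∃ K, ∀ r x, (W (sameL upd (lay upd)) r x).length ≤ K := by
  classical
  refine bounded _ (fun v x => ?_) (fun v x y h1 h2 h3 => ?_)
  · have := (sameL_sublist upd (lay upd) v x).count_le x
    have h := no_heavy hP v x
    refine le_trans ?_ (this.trans h)
    exact le_of_eq (by congr!)
  · by_contra hne
    have := no_barbell hP v x y ((sameL_sublist _ _ _ _).subset h1) ((sameL_sublist _ _ _ _).subset h2)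
      ((sameL_sublist _ _ _ _).subset h3) hne
    have := sameL_lay _ _ _ _ _ h2
    omega

theorem filter_flatMap_eq {Y Z : Type} (l : List Y) (p : Y → Bool) (g : Y → List Z)
    (h : ∀ y ∈ l, p y = false → g y = []) : (l.filter p).flatMap g = l.flatMap g := by
  induction l with
  | nil => simp
  | cons c l ih =>
    have ih := ih (fun y hy => h y (by simp [hy]))
    rw [List.flatMap_cons, List.filter_cons]
    rcases hp : p c with _ | _
    · simp [ih, h c (by simp) hp]
    · simp [ih]

theorem flatMap_length_le' {Y Z : Type} (l : List Y) (g : Y → List Z) (c : ℕ)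
    (h : ∀ y ∈ l, (g y).length ≤ c) : (l.flatMap g).length ≤ l.length * c := by
  induction l with
  | nil => simp
  | cons a l ih =>
    have ih := ih (fun y hy => h y (by simp [hy]))
    have := h a (by simp)
    rw [List.flatMap_cons, List.length_append, List.length_cons]
    nlinarith

theorem length_eq_sum_count [Fintype X] [DecidableEq X] (l : List X) :
    l.length = ∑ y : X, l.count y := by
  induction l with
  | nil => simp
  | cons c l ih =>
    simp only [List.count_cons, Finset.sum_add_distrib, ← ih]
    simp

theorem layered [Finite A] [Finite X] (upd : A → X → List X) (init : X → List B) (out : List X)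
    (f : List A → List B) (hf : ∀ w, f w = out.flatMap (hval upd init w.reverse)) (k : ℕ)
    (hg : ∃ C : ℕ, ∀ w, (f w).length ≤ C * w.length ^ (k + 1) + C) :
    ∃ (upd' : A → X → List X) (out' : List X) (L : X → ℕ),
      (∀ x, L x ≤ k + 1) ∧ (∀ a x, ∀ y ∈ upd' a x, L y ≤ L x) ∧
      (∀ w, f w = out'.flatMap (hval upd' init w.reverse)) ∧
      (∃ K, ∀ r x, (W (sameL upd' L) r x).length ≤ K) ∧
      (∃ K, ∀ r x, L x = 0 → (hval upd' init r x).length ≤ K) := by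
  classical
  have := Fintype.ofFinite X
  obtain ⟨C, hC⟩ := hg
  set coacc : X → Prop := fun y => ∃ p, hval upd init p y ≠ [] with hco
  set upd2 : A → X → List X := fun a x => (upd a x).filter (fun y => coacc y) with hupd2
  set out2 : List X := out.filter (fun y => coacc y) with hout2
  have hnc : ∀ y p, ¬ coacc y → hval upd init p y = [] := by
    intro y p h
    by_contra h'
    exact h ⟨p, h'⟩
  have h2 : ∀ p x, hval upd2 init p x = hval upd init p x := by
    intro p
    induction p with
    | nil => intro x; rfl
    | cons a p ih =>
      intro x
      have : hval upd2 init p = hval upd init p := funext ih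
      simp only [hval]
      rw [this]
      refine filter_flatMap_eq _ (fun y => decide (coacc y)) _ (fun y _ hy => hnc y p (by simpa using hy))
  have hf2 : ∀ w, f w = out2.flatMap (hval upd2 init w.reverse) := by
    intro w
    rw [hf w, funext (h2 w.reverse)]
    symm
    exact filter_flatMap_eq _ _ _ (fun y _ hy => hnc y _ (by simpa using hy))
  have hmem : ∀ r x, coacc x → ∀ y ∈ W upd2 r x, coacc y := by
    intro r
    induction r with
    | nil => intro x hx y hy; simp [W] at hy; rwa [hy]
    | cons a r ih =>
      intro x hx y hy
      simp only [W, List.mem_flatMap, hupd2, List.mem_filter, decide_eq_true_eq] at hy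
      obtain ⟨z, hz, hy⟩ := hy
      exact ih z hz.2 y hy
  have hp : ∀ y, ∃ p, coacc y → hval upd2 init p y ≠ [] := by
    intro y
    by_cases h : coacc y
    · obtain ⟨p, hp⟩ := h
      exact ⟨p, fun _ => by rwa [h2]⟩
    · exact ⟨[], fun h' => absurd h' h⟩
  choose p hp using hp
  obtain ⟨D, hD⟩ := PartA.exists_bound (fun y => (p y).length)
  have hPo : ∀ o ∈ out2, Pb upd2 (k + 1) o := by
    intro o ho
    have hoc : coacc o := by simpa using (List.mem_filter.1 ho).2
    refine ⟨Fintype.card X * (C * (D + 1) ^ (k + 1) + C), fun r => ?_⟩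
    have hcount : ∀ y, (W upd2 r o).count y ≤ C * (r.length + D) ^ (k + 1) + C := by
      intro y
      by_cases hy : y ∈ W upd2 r o
      · have h3 := hp y (hmem r o hoc y hy)
        have h4 := count_mul_le (W upd2 r o) (hval upd2 init (p y)) y
        rw [← hval_append] at h4
        have h5 := length_le_flatMap ho (hval upd2 init (r ++ p y))
        have h6 := hf2 (r ++ p y).reverse
        rw [List.reverse_reverse] at h6
        rw [← h6] at h5
        have h7 := hC (r ++ p y).reverse
        have h8 := List.length_pos_of_ne_nil h3
        have h9 : (r ++ p y).reverse.length ≤ r.length + D := by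
          have := hD y
          simp at this ⊢
          omega
        have h10 := Nat.mul_le_mul_left C (Nat.pow_le_pow_left h9 (k + 1))
        nlinarith
      · rw [List.count_eq_zero_of_not_mem hy]; omega
    rw [length_eq_sum_count]
    refine (Finset.sum_le_sum (fun y _ => hcount y)).trans ?_
    simp only [Finset.sum_const, Finset.card_univ, smul_eq_mul]
    have h3 := Nat.mul_le_mul_left C (PartA.poly_shift D (k + 1) r.length)
    rw [mul_assoc, ← Nat.mul_add]
    refine Nat.mul_le_mul_left _ ?_
    nlinarith [Nat.zero_le (C * r.length ^ (k + 1))]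
  set upd3 : A → X → List X := fun a x => if Pb upd2 (k + 1) x then upd2 a x else [] with hupd3
  have hW3 : ∀ r x, Pb upd2 (k + 1) x → W upd3 r x = W upd2 r x := by
    intro r
    induction r with
    | nil => intro x _; rfl
    | cons a r ih =>
      intro x hx
      simp only [W, hupd3, if_pos hx]
      refine List.flatMap_congr (fun y hy => ih y (Pb_child hx hy))
  have hv3 : ∀ r x, Pb upd2 (k + 1) x → hval upd3 init r x = hval upd2 init r x := by
    intro r
    induction r with
    | nil => intro x _; rfl
    | cons a r ih =>
      intro x hx
      simp only [hval, hupd3, if_pos hx]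
      refine List.flatMap_congr (fun y hy => ih y (Pb_child hx hy))
  have hP3 : ∀ x, Pb upd3 (k + 1) x := by
    intro x
    by_cases hx : Pb upd2 (k + 1) x
    · obtain ⟨C, hC⟩ := hx
      exact ⟨C, fun r => by rw [hW3 r x ⟨C, hC⟩]; exact hC r⟩
    · refine ⟨1, fun r => ?_⟩
      rcases r with _ | ⟨a, r⟩
      · simp [W]
      · simp [W, hupd3, hx]
  refine ⟨upd3, out2, lay upd3, fun x => (lay_spec (hP3 x)).2, ?_, ?_, sameL_bounded hP3, ?_⟩
  · intro a x y hy
    exact (lay_spec (Pb_child (lay_spec (hP3 x)).1 hy)).2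
  · intro w
    rw [hf2 w]
    exact List.flatMap_congr (fun y hy => (hv3 _ y (hPo y hy)).symm)
  · have h0 : ∀ x, ∃ K, lay upd3 x = 0 → ∀ r, (W upd3 r x).length ≤ K := by
      intro x
      obtain ⟨C, hC⟩ := (lay_spec (hP3 x)).1
      refine ⟨C + C, fun h r => ?_⟩
      have := hC r
      rwa [h, pow_zero, mul_one] at this
    choose K hK using h0
    obtain ⟨K1, hK1⟩ := PartA.exists_bound K
    obtain ⟨K2, hK2⟩ := PartA.exists_bound (fun x => (init x).length)
    refine ⟨K1 * K2, fun r x hx => ?_⟩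
    have := hval_append upd3 init r [] x
    rw [List.append_nil] at this
    rw [this]
    exact (flatMap_length_le' _ _ K2 (fun y _ => hK2 y)).trans
      (Nat.mul_le_mul_right _ ((hK x hx r).trans (hK1 x)))

end PartC


/-! ## Part D : construction of a `k`-marble transducer -/

namespace PartD

open Classical in
/-- States of the Hopcroft and Ullman excursion. -/
inductive HS (σ : Type) where
  | srch (G : σ → σ → Option σ) (s1 s2 : σ)
  | ret (M s1 s2 : σ)

inductive HO (σ : Type) where
  | away (h : HS σ)
  | back (h : HS σ)
  | done (M : σ)

instance finiteHS {σ : Type} [Finite σ] : Finite (HS σ) := by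
  let g : HS σ → ((σ → σ → Option σ) × σ × σ) ⊕ (σ × σ × σ) := fun h =>
    match h with
    | .srch G a b => Sum.inl (G, a, b)
    | .ret M a b => Sum.inr (M, a, b)
  apply Finite.of_injective g
  rintro (⟨G, a, b⟩ | ⟨M, a, b⟩) (⟨G', a', b'⟩ | ⟨M', a', b'⟩) h <;> simp [g] at h ⊢ <;> exact h

section HU
variable {σ S : Type} (step : σ → S → σ)

open Classical in
noncomputable def hu (a : S) (anc : Option σ) : HS σ → Option (HO σ)
  | .srch G s1 s2 =>
    match anc with
    | some L0 => (G (step L0 a) L0).map (fun M => .back (.ret M s1 s2))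
    | none =>
      if h : ∃ p : σ × σ, ∃ M M', G (step p.1 a) p.1 = some M ∧ G (step p.2 a) p.2 = some M' ∧ M ≠ M'
      then some (.away (.srch (fun u _ => G (step u a) u) h.choose.1 h.choose.2))
      else if h : ∃ M s, G (step s a) s = some M then some (.back (.ret h.choose s1 s2))
      else none
  | .ret M s1 s2 =>
    if s1 = s2 then some (.done M) else some (.back (.ret M (step s1 a) (step s2 a)))

inductive HRun (sym : ℕ → S) (anc : ℕ → Option σ) (E : ℕ) : HS σ → ℕ → σ → Prop
  | done {h : HS σ} {M : σ} : hu step (sym 0) (anc 0) h = some (.done M) → HRun sym anc E h 0 M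
  | away {h h' : HS σ} {e : ℕ} {M : σ} : 1 ≤ e → e < E →
      hu step (sym e) (anc e) h = some (.away h') → HRun sym anc E h' (e + 1) M →
      HRun sym anc E h e M
  | back {h h' : HS σ} {e : ℕ} {M : σ} : e + 1 ≤ E →
      hu step (sym (e + 1)) (anc (e + 1)) h = some (.back h') → HRun sym anc E h' e M →
      HRun sym anc E h (e + 1) M

def RetOK (sym : ℕ → S) : ℕ → σ → σ → Prop
  | 0, s1, s2 => s1 = s2
  | e + 1, s1, s2 => s1 ≠ s2 ∧ RetOK sym e (step s1 (sym (e + 1))) (step s2 (sym (e + 1)))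

theorem ret_run (sym : ℕ → S) (anc : ℕ → Option σ) (E : ℕ) (M : σ) :
    ∀ e s1 s2, e ≤ E → RetOK step sym e s1 s2 → HRun step sym anc E (.ret M s1 s2) e M := by
  intro e
  induction e with
  | zero =>
    intro s1 s2 _ h
    exact .done (by simp [hu, show s1 = s2 from h])
  | succ e ih =>
    intro s1 s2 he h
    obtain ⟨h1, h2⟩ := h
    exact .back he (by simp [hu, h1]) (ih _ _ (by omega) h2)

theorem srch_run (sym : ℕ → S) (anc : ℕ → Option σ) (E : ℕ) (ann : ℕ → σ)
    (hann : ∀ e, e < E → step (ann (e + 1)) (sym (e + 1)) = ann e)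
    (hE : anc E = some (ann E)) (hn : ∀ e, 1 ≤ e → e < E → anc e = none) :
    ∀ d e G s1 s2, d + (e + 1) = E → G (ann e) (ann (e + 1)) = some (ann 1) →
      RetOK step sym e s1 s2 →
      (∀ u1 u2 M M', G (step u1 (sym (e + 1))) u1 = some M →
        G (step u2 (sym (e + 1))) u2 = some M' → M ≠ M' → RetOK step sym (e + 1) u1 u2) →
      HRun step sym anc E (.srch G s1 s2) (e + 1) (ann 1) := by
  intro d
  induction d with
  | zero =>
    intro e G s1 s2 hd hG hr _
    have : e + 1 = E := by omega
    refine .back (by omega) (h' := .ret (ann 1) s1 s2) ?_ (ret_run _ _ _ _ _ _ _ _ (by omega) hr)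
    rw [this, hE]
    simp only [hu]
    rw [← this, hann e (by omega), hG]; rfl
  | succ d ih =>
    intro e G s1 s2 hd hG hr hdiff
    have hg : G (step (ann (e + 1)) (sym (e + 1))) (ann (e + 1)) = some (ann 1) := by
      rw [hann e (by omega), hG]
    have ha := hn (e + 1) (by omega) (by omega)
    by_cases h : ∃ p : σ × σ, ∃ M M', G (step p.1 (sym (e + 1))) p.1 = some M ∧
        G (step p.2 (sym (e + 1))) p.2 = some M' ∧ M ≠ M'
    · obtain ⟨M, M', h1, h2, h3⟩ := h.choose_spec
      refine .away (by omega) (by omega)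
        (h' := .srch (fun u _ => G (step u (sym (e + 1))) u) h.choose.1 h.choose.2) ?_
        (ih (e + 1) _ _ _ (by omega) hg (hdiff _ _ _ _ h1 h2 h3) ?_)
      · rw [ha]; simp only [hu, dif_pos h]
      · intro u1 u2 N N' g1 g2 g3
        refine ⟨?_, hdiff _ _ _ _ g1 g2 g3⟩
        rintro rfl
        exact g3 (Option.some.inj (g1.symm.trans g2))
    · have h' : ∃ M s, G (step s (sym (e + 1))) s = some M := ⟨_, _, hg⟩
      have hM : h'.choose = ann 1 := by
        obtain ⟨s, hs⟩ := h'.choose_spec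
        by_contra hne
        exact h ⟨(s, ann (e + 1)), _, _, hs, hg, hne⟩
      refine .back (by omega) (h' := .ret (ann 1) s1 s2) ?_ (ret_run _ _ _ _ _ _ _ _ (by omega) hr)
      rw [ha]; simp only [hu, dif_neg h, dif_pos h', hM]

open Classical in
noncomputable def hstart (s0 : σ) : HS σ :=
  .srch (fun u s => if u = s0 then some s else none) s0 s0

theorem hu_run (sym : ℕ → S) (anc : ℕ → Option σ) (E : ℕ) (ann : ℕ → σ) (h1 : 1 ≤ E)
    (hann : ∀ e, e < E → step (ann (e + 1)) (sym (e + 1)) = ann e)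
    (hE : anc E = some (ann E)) (hn : ∀ e, 1 ≤ e → e < E → anc e = none) :
    HRun step sym anc E (hstart (ann 0)) 1 (ann 1) := by
  refine srch_run step sym anc E ann hann hE hn (E - 1) 0 _ _ _ (by omega) (by simp) rfl ?_
  intro u1 u2 M M' g1 g2 g3
  simp only [Option.ite_none_right_eq_some, Option.some.injEq] at g1 g2
  refine ⟨?_, ?_⟩
  · rintro rfl; exact g3 (g1.2.symm.trans g2.2)
  · exact g1.1.trans g2.1.symm

end HU

/-! ### Machines with an oracle -/

variable {A B : Type}

inductive Step {Q C E : Type} (δ : Q → TapeSym A → Option C → E → Option ((Q × MAct C) × List B))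
    (k : ℕ) (w : List A) (ann : ℕ → List (C × ℕ) → E) :
    Q × ℕ × List (C × ℕ) → List B → Q × ℕ × List (C × ℕ) → Prop
  | L {q : Q} {m : ℕ} {π : List (C × ℕ)} {q' : Q} {v : List B} :
      δ q (tapeAt w (m + 1)) (marbleAt (m + 1) π) (ann (m + 1) π) = some ((q', MAct.left), v) →
      Step δ k w ann (q, m + 1, π) v (q', m, π)
  | R {q : Q} {m : ℕ} {π : List (C × ℕ)} {q' : Q} {v : List B} :
      marbleAt m π = none →
      δ q (tapeAt w m) none (ann m π) = some ((q', MAct.right), v) → m ≤ w.length →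
      Step δ k w ann (q, m, π) v (q', m + 1, π)
  | lift {q : Q} {m : ℕ} {π : List (C × ℕ)} {q' : Q} {cc : C} {v : List B} :
      δ q (tapeAt w m) (some cc) (ann m ((cc, m) :: π)) = some ((q', MAct.lift), v) →
      Step δ k w ann (q, m, (cc, m) :: π) v (q', m, π)
  | drop {q : Q} {m : ℕ} {π : List (C × ℕ)} {q' : Q} {cc : C} {v : List B} :
      marbleAt m π = none → π.length < k →
      δ q (tapeAt w m) none (ann m π) = some ((q', MAct.drop cc), v) →
      Step δ k w ann (q, m, π) v (q', m, (cc, m) :: π)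

inductive Run {Q C E : Type} (δ : Q → TapeSym A → Option C → E → Option ((Q × MAct C) × List B))
    (k : ℕ) (w : List A) (ann : ℕ → List (C × ℕ) → E) :
    Q × ℕ × List (C × ℕ) → List B → Q × ℕ × List (C × ℕ) → Prop
  | refl (c : Q × ℕ × List (C × ℕ)) : Run δ k w ann c [] c
  | cons {c c' d : Q × ℕ × List (C × ℕ)} {v u : List B} :
      Step δ k w ann c v c' → Run δ k w ann c' u d → Run δ k w ann c (v ++ u) d

section
variable {Q C E : Type} {δ : Q → TapeSym A → Option C → E → Option ((Q × MAct C) × List B)}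
    {k : ℕ} {w : List A} {ann : ℕ → List (C × ℕ) → E}

theorem Run.trans {c d e : Q × ℕ × List (C × ℕ)} {v u : List B} (h : Run δ k w ann c v d)
    (h2 : Run δ k w ann d u e) : Run δ k w ann c (v ++ u) e := by
  induction h with
  | refl => simpa
  | cons s _ ih => rw [List.append_assoc]; exact .cons s (ih h2)

theorem Run.one {c d : Q × ℕ × List (C × ℕ)} {v : List B} (h : Step δ k w ann c v d) :
    Run δ k w ann c v d := by
  simpa using Run.cons h (.refl _)

theorem Run.cons0 {c c' d : Q × ℕ × List (C × ℕ)} {u : List B}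
    (h : Step δ k w ann c [] c') (h2 : Run δ k w ann c' u d) : Run δ k w ann c u d := .cons h h2

/-- Well-formed head position and stack. -/
def Wf {C : Type} (n m : ℕ) (π : List (C × ℕ)) : Prop :=
  m ≤ n + 1 ∧ (∀ x ∈ π, m ≤ x.2 ∧ x.2 ≤ n + 1) ∧ π.Pairwise (fun x y => x.2 < y.2)

theorem Wf.lt {n m : ℕ} {π : List (C × ℕ)} (h : Wf n m π) (hm : marbleAt m π = none) :
    ∀ x ∈ π, m < x.2 := by
  obtain ⟨h1, h2, h3⟩ := h
  cases π with
  | nil => simp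
  | cons y π =>
    obtain ⟨c, p⟩ := y
    have hp : p ≠ m := by
      intro h; simp [marbleAt, h] at hm
    have hp2 := (h2 (c, p) (by simp)).1
    intro x hx
    rcases List.mem_cons.1 hx with rfl | hx
    · exact lt_of_le_of_ne hp2 (Ne.symm hp)
    · have := (List.pairwise_cons.1 h3).1 x hx
      simp at this hp2; omega

theorem marbleAt_none_of_lt {m : ℕ} {π : List (C × ℕ)} (h : ∀ x ∈ π, m < x.2) :
    marbleAt m π = none := by
  cases π with
  | nil => rfl
  | cons y π =>
    obtain ⟨c, p⟩ := y
    have := h (c, p) (by simp)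
    simp at this
    simp [marbleAt]; omega

theorem Wf.step {c d : Q × ℕ × List (C × ℕ)} {v : List B} (hs : Step δ k w ann c v d)
    (h : Wf w.length c.2.1 c.2.2) : Wf w.length d.2.1 d.2.2 := by
  cases hs with
  | L _ =>
    obtain ⟨h1, h2, h3⟩ := h
    simp only at h1 h2 h3 ⊢
    exact ⟨by omega, fun x hx => ⟨by have := (h2 x hx).1; omega, (h2 x hx).2⟩, h3⟩
  | R hn _ hm =>
    have h4 := h.lt hn
    obtain ⟨h1, h2, h3⟩ := h
    exact ⟨by simp only; omega, fun x hx => ⟨h4 x hx, (h2 x hx).2⟩, h3⟩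
  | lift _ =>
    obtain ⟨h1, h2, h3⟩ := h
    exact ⟨h1, fun x hx => h2 x (List.mem_cons_of_mem _ hx), (List.pairwise_cons.1 h3).2⟩
  | drop hn _ _ =>
    have h4 := h.lt hn
    obtain ⟨h1, h2, h3⟩ := h
    refine ⟨h1, ?_, List.pairwise_cons.2 ⟨h4, h3⟩⟩
    intro x hx
    rcases List.mem_cons.1 hx with rfl | hx
    · exact ⟨le_rfl, h1⟩
    · exact h2 x hx

theorem Run.elim {P : Q × ℕ × List (C × ℕ) → List B → Q × ℕ × List (C × ℕ) → Prop}
    (h0 : ∀ c, P c [] c)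
    (h1 : ∀ c v c' u d, Wf w.length c.2.1 c.2.2 → Step δ k w ann c v c' → P c' u d →
      P c (v ++ u) d)
    {c d : Q × ℕ × List (C × ℕ)} {v : List B} (h : Run δ k w ann c v d)
    (hw : Wf w.length c.2.1 c.2.2) : P c v d := by
  induction h with
  | refl c => exact h0 c
  | cons s _ ih => exact h1 _ _ _ _ _ hw s (ih (hw.step s))

end

/-! ### Removing a left-to-right annotation -/

section T1
variable {Q C E N : Type} (δ : Q → TapeSym A → Option C → E × N → Option ((Q × MAct C) × List B))
  (stepN : N → TapeSym A → N) (ν0 : N)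

def annN (w : List A) : ℕ → N
  | 0 => ν0
  | m + 1 => stepN (annN w m) (tapeAt w m)

def ancN (s : TapeSym A) : Option N :=
  match s with
  | .lend => some ν0
  | _ => none

noncomputable def δ1 : (Q × N) ⊕ (HS N × Q) → TapeSym A → Option C → E →
    Option ((((Q × N) ⊕ (HS N × Q)) × MAct C) × List B)
  | .inl (q, ν), s, c, e =>
    match δ q s c (e, ν) with
    | some ((q', .left), v) => some ((.inr (hstart ν, q'), .left), v)
    | some ((q', .right), v) => some ((.inl (q', stepN ν s), .right), v)
    | some ((q', .lift), v) => some ((.inl (q', ν), .lift), v)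
    | some ((q', .drop cc), v) => some ((.inl (q', ν), .drop cc), v)
    | none => none
  | .inr (h, q'), s, _, _ =>
    match hu stepN s (ancN ν0 s) h with
    | some (.away h') => some ((.inr (h', q'), .left), [])
    | some (.back h') => some ((.inr (h', q'), .right), [])
    | some (.done M) => some ((.inl (q', M), .left), [])
    | none => none

theorem hrun1 {k : ℕ} {w : List A} {ann : ℕ → List (C × ℕ) → E} {π : List (C × ℕ)} {m : ℕ}
    (hm : m ≤ w.length) (hπ : ∀ x ∈ π, m + 1 ≤ x.2) {q' : Q} {h : HS N} {e : ℕ} {M : N}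
    (hr : HRun stepN (fun e => tapeAt w (m + 1 - e)) (fun e => ancN ν0 (tapeAt w (m + 1 - e)))
      (m + 1) h e M) (he : e ≤ m + 1) :
    Run (δ1 δ stepN ν0) k w ann (.inr (h, q'), m + 1 - e, π) [] (.inl (q', M), m, π) := by
  induction hr with
  | done h1 =>
    refine Run.one (.L ?_)
    simp only [Nat.sub_zero] at h1
    simp [δ1, h1]
  | @away h h' e M h1 h2 h3 _ ih =>
    refine Run.cons0 ?_ (ih (by omega))
    rw [show m + 1 - e = (m + 1 - (e + 1)) + 1 by omega] at h3 ⊢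
    exact .L (by simp only [δ1, h3])
  | @back h h' e M h1 h3 _ ih =>
    refine Run.cons0 ?_ (ih (by omega))
    rw [show m + 1 - e = (m + 1 - (e + 1)) + 1 by omega]
    refine .R (marbleAt_none_of_lt fun x hx => ?_) (by simp only [δ1, h3]) (by omega)
    have := hπ x hx
    omega

theorem run1 {k : ℕ} {w : List A} {ann : ℕ → List (C × ℕ) → E}
    {c d : Q × ℕ × List (C × ℕ)} {v : List B}
    (h : Run δ k w (fun m π => (ann m π, annN stepN ν0 w m)) c v d)
    (hw : Wf w.length c.2.1 c.2.2) :
    Run (δ1 δ stepN ν0) k w ann (.inl (c.1, annN stepN ν0 w c.2.1), c.2)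
      v (.inl (d.1, annN stepN ν0 w d.2.1), d.2) := by
  refine Run.elim (P := fun c v d => Run (δ1 δ stepN ν0) k w ann
    (.inl (c.1, annN stepN ν0 w c.2.1), c.2) v (.inl (d.1, annN stepN ν0 w d.2.1), d.2))
    (fun c => .refl _) ?_ h hw
  rintro c v c' u d hw hs ih
  refine Run.trans ?_ ih
  cases hs with
  | @L q m π q' v hd =>
    have hr := hrun1 (δ := δ) (k := k) (ann := ann) stepN ν0 (π := π) (m := m) (q' := q')
      (by have := hw.1; simp at this; omega) (fun x hx => (hw.2.1 x hx).1)
      (hu_run stepN (fun e => tapeAt w (m + 1 - e)) (fun e => ancN ν0 (tapeAt w (m + 1 - e)))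
        (m + 1) (fun e => annN stepN ν0 w (m + 1 - e)) (by omega) ?_ ?_ ?_) (by omega)
    · rw [← List.append_nil v]
      refine Run.cons ?_ hr
      exact .L (by simp only [δ1, hd, Nat.sub_zero])
    · intro e he
      show stepN (annN stepN ν0 w (m + 1 - (e + 1))) _ = annN stepN ν0 w (m + 1 - e)
      rw [show m + 1 - e = (m + 1 - (e + 1)) + 1 by omega]; rfl
    · simp [annN, ancN, (PartB.tapeAt_lend (w := w) (m := 0)).2 rfl]
    · intro e h1 h2
      have : ¬ tapeAt w (m + 1 - e) = .lend := by
        rw [PartB.tapeAt_lend]; omega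
      show ancN ν0 (tapeAt w (m + 1 - e)) = none
      revert this
      cases tapeAt w (m + 1 - e) <;> simp [ancN]
  | R h0 hd hm => exact Run.one (.R h0 (by simp only [δ1, hd]; rfl) hm)
  | lift hd => exact Run.one (.lift (by simp only [δ1, hd]))
  | drop h0 hk hd => exact Run.one (.drop h0 hk (by simp only [δ1, hd]))

end T1

end PartD


namespace PartD

variable {A B : Type}

/-! ### Removing a right-to-left annotation anchored at the top marble -/

section T2
variable {Q C σ : Type} (δ : Q → TapeSym A → Option C → σ → Option ((Q × MAct C) × List B))
  (stepR : σ → TapeSym A → σ) (aRoot : σ) (aC : C → σ)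

def chain (w : List A) (s0 : σ) (p : ℕ) : ℕ → σ
  | 0 => s0
  | d + 1 => stepR (chain w s0 p d) (tapeAt w (p - d))

def anPos {C : Type} (w : List A) : List (C × ℕ) → ℕ
  | [] => w.length + 1
  | (_, p) :: _ => p

def anVal : List (C × ℕ) → σ
  | [] => aRoot
  | (c, _) :: _ => aC c

def annR (w : List A) (m : ℕ) (π : List (C × ℕ)) : σ :=
  chain stepR w (anVal aRoot aC π) (anPos w π) (anPos w π - m)

theorem annR_step (w : List A) (m : ℕ) (π : List (C × ℕ)) (h : m < anPos w π) :
    stepR (annR stepR aRoot aC w (m + 1) π) (tapeAt w (m + 1)) = annR stepR aRoot aC w m π := by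
  unfold annR
  obtain ⟨d, hd⟩ : ∃ d, anPos w π = m + 1 + d := ⟨anPos w π - (m + 1), by omega⟩
  rw [hd, show m + 1 + d - (m + 1) = d by omega, show m + 1 + d - m = d + 1 by omega]
  simp only [chain]
  rw [show m + 1 + d - d = m + 1 by omega]

theorem annR_top (w : List A) (m : ℕ) (c : C) (π : List (C × ℕ)) :
    annR stepR aRoot aC w m ((c, m) :: π) = aC c := by
  simp [annR, anPos, anVal, chain]

def ancR (s : TapeSym A) : Option (C × σ) → Option σ
  | some c => some (aC c.1)
  | none => match s with
    | .rend => some aRoot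
    | _ => none

noncomputable def δ2 : (Q × σ) ⊕ (HS σ × Q) → TapeSym A → Option (C × σ) → Unit →
    Option ((((Q × σ) ⊕ (HS σ × Q)) × MAct (C × σ)) × List B)
  | .inl (q, L), s, c, _ =>
    match δ q s (c.map Prod.fst) L with
    | some ((q', .left), v) => some ((.inl (q', stepR L s), .left), v)
    | some ((q', .right), v) => some ((.inr (hstart L, q'), .right), v)
    | some ((q', .lift), v) =>
      match c with
      | some (_, L') => some ((.inl (q', L'), .lift), v)
      | none => none
    | some ((q', .drop cc), v) => some ((.inl (q', aC cc), .drop (cc, L)), v)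
    | none => none
  | .inr (h, q'), s, c, _ =>
    match hu stepR s (ancR aRoot aC s c) h with
    | some (.away h') => some ((.inr (h', q'), .right), [])
    | some (.back h') => some ((.inr (h', q'), .left), [])
    | some (.done M) => some ((.inl (q', M), .right), [])
    | none => none

def enc (w : List A) : List (C × ℕ) → List ((C × σ) × ℕ)
  | [] => []
  | (c, p) :: π => ((c, annR stepR aRoot aC w p π), p) :: enc w π

theorem enc_length (w : List A) (π : List (C × ℕ)) :
    (enc stepR aRoot aC w π).length = π.length := by
  induction π with
  | nil => rfl
  | cons x π ih => obtain ⟨c, p⟩ := x; simp [enc, ih]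

theorem marbleAt_enc (w : List A) (m : ℕ) (π : List (C × ℕ)) :
    (marbleAt m (enc stepR aRoot aC w π)).map Prod.fst = marbleAt m π := by
  cases π with
  | nil => rfl
  | cons x π =>
    obtain ⟨c, p⟩ := x
    simp only [enc, marbleAt]
    split_ifs <;> rfl

theorem marbleAt_enc_none (w : List A) (m : ℕ) (π : List (C × ℕ)) (h : marbleAt m π = none) :
    marbleAt m (enc stepR aRoot aC w π) = none := by
  have := marbleAt_enc stepR aRoot aC w m π
  rw [h] at this
  exact Option.map_eq_none_iff.1 this

theorem marbleAt_ne {C : Type} (w : List A) (m : ℕ) (π : List (C × ℕ)) (h : m ≠ anPos w π) :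
    marbleAt m π = none := by
  cases π with
  | nil => rfl
  | cons x π => 
    obtain ⟨c, p⟩ := x
    simp only [anPos] at h
    simp only [marbleAt, if_neg (Ne.symm h)]

theorem Wf.anPos_le {w : List A} {m : ℕ} {π : List (C × ℕ)} (h : Wf w.length m π) :
    m ≤ anPos w π ∧ anPos w π ≤ w.length + 1 := by
  cases π with
  | nil => exact ⟨h.1, le_rfl⟩
  | cons x π => exact h.2.1 x (by simp)

theorem hrun2 {k : ℕ} {w : List A} {ann : ℕ → List ((C × σ) × ℕ) → Unit}
    {π : List (C × ℕ)} {m : ℕ}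
    (hm : m < anPos w π) (hn : anPos w π ≤ w.length + 1) {q' : Q} {h : HS σ} {e : ℕ} {M : σ}
    (hr : HRun stepR (fun e => tapeAt w (m + e))
      (fun e => ancR aRoot aC (tapeAt w (m + e)) (marbleAt (m + e) (enc stepR aRoot aC w π)))
      (anPos w π - m) h e M) (he : e ≤ anPos w π - m) :
    Run (δ2 δ stepR aRoot aC) k w ann (.inr (h, q'), m + e, enc stepR aRoot aC w π) []
      (.inl (q', M), m + 1, enc stepR aRoot aC w π) := by
  have hno : ∀ e, e < anPos w π - m → marbleAt (m + e) (enc stepR aRoot aC w π) = none :=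
    fun e he => marbleAt_enc_none _ _ _ _ _ _ (marbleAt_ne w _ _ (by omega))
  induction hr with
  | done h1 =>
    have h0 := hno 0 (by omega)
    refine Run.one (.R h0 ?_ (by omega))
    simp only [h0] at h1
    simp only [δ2, h1]
  | @away h h' e M h1 h2 h3 _ ih =>
    refine Run.cons0 ?_ (ih (by omega))
    have h0 := hno e (by omega)
    simp only [h0] at h3
    exact .R h0 (by simp only [δ2, h3]) (by omega)
  | @back h h' e M h1 h3 _ ih =>
    refine Run.cons0 ?_ (ih (by omega))
    exact .L (m := m + e) (by simp only [← add_assoc] at h3; simp only [δ2, h3])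

theorem run2 {k : ℕ} {w : List A}
    {c d : Q × ℕ × List (C × ℕ)} {v : List B}
    (h : Run δ k w (fun m π => annR stepR aRoot aC w m π) c v d)
    (hw : Wf w.length c.2.1 c.2.2) :
    Run (δ2 δ stepR aRoot aC) k w (fun _ _ => ())
      (.inl (c.1, annR stepR aRoot aC w c.2.1 c.2.2), c.2.1, enc stepR aRoot aC w c.2.2)
      v (.inl (d.1, annR stepR aRoot aC w d.2.1 d.2.2), d.2.1, enc stepR aRoot aC w d.2.2) := by
  refine Run.elim (P := fun c v d => Run (δ2 δ stepR aRoot aC) k w (fun _ _ => ())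
      (.inl (c.1, annR stepR aRoot aC w c.2.1 c.2.2), c.2.1, enc stepR aRoot aC w c.2.2)
      v (.inl (d.1, annR stepR aRoot aC w d.2.1 d.2.2), d.2.1, enc stepR aRoot aC w d.2.2))
    (fun c => .refl _) ?_ h hw
  rintro c v c' u d hw hs ih
  refine Run.trans ?_ ih
  have hp := hw.anPos_le
  cases hs with
  | @L q m π q' v hd =>
    simp only at hp ⊢
    refine Run.one (.L ?_)
    simp only [δ2, marbleAt_enc, hd]
    rw [annR_step stepR aRoot aC w m π (by omega)]
  | @R q m π q' v h0 hd hm =>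
    simp only at hp ⊢
    have hlt : m < anPos w π := by
      cases π with
      | nil => simp [anPos]; omega
      | cons x π =>  exact hw.lt h0 x (by simp)
    have hr := hrun2 (δ := δ) (k := k) (ann := fun _ _ => ()) stepR aRoot aC (π := π) (m := m)
      (q' := q') hlt hp.2
      (hu_run stepR (fun e => tapeAt w (m + e))
        (fun e => ancR aRoot aC (tapeAt w (m + e)) (marbleAt (m + e) (enc stepR aRoot aC w π)))
        (anPos w π - m) (fun e => annR stepR aRoot aC w (m + e) π) (by omega) ?_ ?_ ?_) (by omega)
    · rw [← List.append_nil v]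
      refine Run.cons ?_ hr
      refine .R (marbleAt_enc_none _ _ _ _ _ _ h0) ?_ hm
      simp only [δ2, Option.map_none, hd, Nat.add_zero]
    · intro e he
      exact annR_step stepR aRoot aC w (m + e) π (by omega)
    · simp only [show m + (anPos w π - m) = anPos w π by omega]
      cases π with
      | nil =>
        simp only [enc, marbleAt, ancR, anPos, annR, Nat.sub_self, chain, anVal,
          (PartB.tapeAt_rend (w := w) (m := w.length + 1)).2 le_rfl]
      | cons x π =>
        obtain ⟨c, p⟩ := x
        simp only [enc, marbleAt, ancR, anPos, annR, Nat.sub_self, chain, anVal, if_true]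
    · intro e h1 h2
      have h3 : ¬ tapeAt w (m + e) = .rend := by
        rw [PartB.tapeAt_rend]
        clear hd
        omega
      simp only [marbleAt_enc_none stepR aRoot aC w (m + e) π (marbleAt_ne w _ _ (by omega))]
      revert h3
      cases tapeAt w (m + e) <;> simp [ancR]
  | @lift q m π q' cc v hd =>
    refine Run.one (.lift ?_)
    simp only [δ2, Option.map_some, hd]
  | @drop q m π q' cc v h0 hk hd =>
    refine Run.one ?_
    simp only [enc, annR_top]
    refine .drop (marbleAt_enc_none _ _ _ _ _ _ h0) (by rwa [enc_length]) ?_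
    simp only [δ2, Option.map_none, hd]

end T2

/-! ### From oracle-free machines to marble transducers -/

section Wrap
variable {Q C : Type} (δ : Q → TapeSym A → Option C → Unit → Option ((Q × MAct C) × List B)) (k : ℕ)

def wact (i : Fin (k + 1)) (c : Option C) : Option ((Q × MAct C) × List B) →
    Option (((Q × Fin (k + 1)) × MAct C) × List B)
  | some ((q', .left), v) => some (((q', i), .left), v)
  | some ((q', .right), v) =>
    match c with
    | none => some (((q', i), .right), v)
    | some _ => none
  | some ((q', .lift), v) =>
    match c with
    | some _ => some (((q', ⟨i.1 - 1, by omega⟩), .lift), v)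
    | none => none
  | some ((q', .drop cc), v) =>
    match c with
    | none => if h : i.1 < k then some (((q', ⟨i.1 + 1, by omega⟩), .drop cc), v) else none
    | some _ => none
  | none => none

def wtrans (q : Q × Fin (k + 1)) (s : TapeSym A) (c : Option C) :
    Option (((Q × Fin (k + 1)) × MAct C) × List B) :=
  wact k q.2 c (δ q.1 s c ())

noncomputable def wrap [Finite Q] [Finite C] (q0 : Q) (F : Set Q) : MarbleT A B where
  Q := Q × Fin (k + 1)
  C := C
  finQ := @Fintype.ofFinite _ (Finite.instProd)
  finC := Fintype.ofFinite C
  q0 := (q0, 0)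
  final := {p | p.1 ∈ F}
  trans := wtrans δ k
  marble_left_or_lift := by
    rintro ⟨q, i⟩ s c p h
    unfold wtrans at h
    revert h
    generalize δ (q, i).1 s (some c) () = o
    rcases o with _ | ⟨⟨q', (_ | _ | _ | _)⟩, v⟩ <;> simp [wact] <;> rintro rfl <;> simp

theorem wtrans_spec {q : Q × Fin (k + 1)} {s : TapeSym A} {c : Option C} {q' : Q × Fin (k + 1)}
    {a : MAct C} {v : List B} : wtrans δ k q s c = some ((q', a), v) →
    match a with
    | .lift => q'.2.1 = q.2.1 - 1
    | .drop _ => q'.2.1 = q.2.1 + 1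
    | _ => q'.2.1 = q.2.1 := by
  unfold wtrans
  generalize δ q.1 s c () = o
  rcases o with _ | ⟨⟨q1, (_ | _ | _ | _)⟩, v⟩ <;> rcases c with _ | c <;> simp only [wact] <;>
    intro h <;> first | (cases h; done) | (cases h; rfl) | skip
  split_ifs at h
  cases h; rfl

theorem wtrans_eq {q : Q} {i : Fin (k + 1)} {s : TapeSym A} {c : Option C}
    {o : Option ((Q × MAct C) × List B)} {r : Option (((Q × Fin (k + 1)) × MAct C) × List B)}
    (h : δ q s c () = o) (h2 : wact k i c o = r) : wtrans δ k (q, i) s c = r := by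
  subst h; exact h2

variable [Finite Q] [Finite C] (q0 : Q) (F : Set Q)

theorem wrap_count (w : List A) {c d : (wrap δ k q0 F).Q × ℕ × List ((wrap δ k q0 F).C × ℕ)} {v}
    (h : MarbleT.Steps (wrap δ k q0 F) w c v d) :
    c.2.2.length = (show Q × Fin (k + 1) from c.1).2.1 →
      d.2.2.length = (show Q × Fin (k + 1) from d.1).2.1 := by
  refine PartA.Steps_elim (P := fun c v d =>
    c.2.2.length = (show Q × Fin (k + 1) from c.1).2.1 →
      d.2.2.length = (show Q × Fin (k + 1) from d.1).2.1)
    (fun c h => h) ?_ h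
  intro c v c' u d hs _ ih hc
  apply ih
  cases hs with
  | L h1 _ => exact hc.trans (wtrans_spec δ k h1).symm
  | R _ h1 _ => exact hc.trans (wtrans_spec δ k h1).symm
  | lift h1 => 
    have := wtrans_spec δ k h1
    simp only [List.length_cons] at hc ⊢
    omega
  | drop _ h1 =>
    have := wtrans_spec δ k h1
    simp only [List.length_cons] at hc ⊢
    omega

theorem wrap_isK : (wrap δ k q0 F).IsKMarble k := by
  intro w u cfg h
  have := wrap_count δ k q0 F w h rfl
  have h2 := cfg.1.2.2
  omega

theorem step1_det {T : MarbleT A B} {w : List A} {c c1 c2 v1 v2}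
    (h1 : PartA.Step1 T w c v1 c1) (h2 : PartA.Step1 T w c v2 c2) : v1 = v2 ∧ c1 = c2 := by
  cases h1 with
  | L a b => 
    cases h2 with
    | L a' b' => rw [a] at a'; simp at a'; obtain ⟨rfl, rfl⟩ := a'; exact ⟨rfl, rfl⟩
    | R h a' b' => rw [h, a'] at a; simp at a
    | lift a' => simp [marbleAt, a'] at a
    | drop h a' => rw [h, a'] at a; simp at a
  | R h a b =>
    cases h2 with
    | L a' b' => rw [h, a] at a'; simp at a'
    | R h a' b' => rw [a] at a'; simp at a'; obtain ⟨rfl, rfl⟩ := a'; exact ⟨rfl, rfl⟩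
    | lift a' => simp [marbleAt] at h
    | drop h a' => rw [a] at a'; simp at a'
  | lift a =>
    cases h2 with
    | L a' b' => simp [marbleAt, a] at a'
    | R h a' b' => simp [marbleAt] at h
    | lift a' => rw [a] at a'; simp at a'; obtain ⟨rfl, rfl⟩ := a'; exact ⟨rfl, rfl⟩
    | drop h a' => simp [marbleAt] at h
  | drop h a =>
    cases h2 with
    | L a' b' => rw [h, a] at a'; simp at a'
    | R h a' b' => rw [a] at a'; simp at a'
    | lift a' => simp [marbleAt] at h
    | drop h a' =>
      rw [a] at a'; simp at a'; obtain ⟨⟨rfl, rfl⟩, rfl⟩ := a'; exact ⟨rfl, rfl⟩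

theorem steps_det {T : MarbleT A B} {w : List A} {c d v}
    (h : MarbleT.Steps T w c v d) (hd : ∀ u e, ¬ PartA.Step1 T w d u e) :
    ∀ {v' d'}, MarbleT.Steps T w c v' d' → (∀ u e, ¬ PartA.Step1 T w d' u e) → v = v' := by
  revert hd
  refine PartA.Steps_elim (P := fun c v d => (∀ u e, ¬ PartA.Step1 T w d u e) →
    ∀ {v' d'}, MarbleT.Steps T w c v' d' → (∀ u e, ¬ PartA.Step1 T w d' u e) → v = v') ?_ ?_ h
  · intro c hc v' d' h2
    refine PartA.Steps_elim (P := fun c v d => (∀ u e, ¬ PartA.Step1 T w c u e) →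
      (∀ u e, ¬ PartA.Step1 T w d u e) → [] = v) (fun _ _ _ => rfl) ?_ h2 hc
    intro c v c' u d hs _ _ hc
    exact absurd hs (hc _ _)
  · intro c v c' u d hs _ ih hd v' d' h2
    revert hs
    refine PartA.Steps_elim (P := fun c v'' d' => PartA.Step1 T w c v c' →
      (∀ u e, ¬ PartA.Step1 T w d' u e) → v ++ u = v'') ?_ ?_ h2
    · intro c hs hc; exact absurd hs (hc _ _)
    · intro c v1 c1 u1 d1 hs1 hr _ hs hd1
      obtain ⟨rfl, rfl⟩ := step1_det hs hs1
      rw [ih hd hr hd1]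

theorem wrapped_of_run {w : List A} {c d : Q × ℕ × List (C × ℕ)} {v : List B}
    (h : Run δ k w (fun _ _ => ()) c v d) : ∀ i : Fin (k + 1), i.1 = c.2.2.length →
    ∃ j, MarbleT.Steps (wrap δ k q0 F) w ((c.1, i), c.2) v ((d.1, j), d.2) := by
  induction h with
  | refl c => exact fun i _ => ⟨i, .refl _⟩
  | @cons c c' d v u hs _ ih =>
    intro i hi
    suffices ∃ i' : Fin (k + 1), i'.1 = c'.2.2.length ∧
        PartA.Step1 (wrap δ k q0 F) w ((c.1, i), c.2) v ((c'.1, i'), c'.2) by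
      obtain ⟨i', h1, h2⟩ := this
      obtain ⟨j, hj⟩ := ih i' h1
      exact ⟨j, h2.cons hj⟩
    cases hs with
    | @L q m π q' v hd =>
      refine ⟨i, hi, PartA.Step1.L (T := wrap δ k q0 F) (q := (q, i)) (m := m + 1) ?_ (by omega)⟩
      exact wtrans_eq δ k hd rfl
    | R h0 hd hm =>
      refine ⟨i, hi, PartA.Step1.R h0 ?_ hm⟩
      exact wtrans_eq δ k hd rfl
    | lift hd =>
      refine ⟨⟨i.1 - 1, by omega⟩, by simp [hi], PartA.Step1.lift ?_⟩
      exact wtrans_eq δ k hd rfl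
    | drop h0 hk hd =>
      simp only at hi
      refine ⟨⟨i.1 + 1, by omega⟩, by simp [hi], PartA.Step1.drop h0 ?_⟩
      exact wtrans_eq δ k hd (dif_pos (by omega))

theorem wrap_computes (f : List A → List B) (hF : ∀ q ∈ F, ∀ s c, δ q s c () = none)
    (hrun : ∀ w, ∃ q ∈ F, Run δ k w (fun _ _ => ()) (q0, 0, []) (f w) (q, w.length + 1, [])) :
    ComputableKMarble f k := by
  refine ⟨wrap δ k q0 F, wrap_isK δ k q0 F, ?_⟩
  have hstuck : ∀ w (q : (wrap δ k q0 F).Q) (m : ℕ) (π : List ((wrap δ k q0 F).C × ℕ)),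
      q ∈ (wrap δ k q0 F).final → ∀ u e, ¬ PartA.Step1 (wrap δ k q0 F) w (q, m, π) u e := by
    intro w q m π hq u e hs
    have hn : ∀ s c, (wrap δ k q0 F).trans q s c = none := by
      intro s c
      exact wtrans_eq δ k (hF q.1 hq s c) rfl
    cases hs with
    | L a _ => rw [hn] at a; simp at a
    | R _ a _ => rw [hn] at a; simp at a
    | lift a => rw [hn] at a; simp at a
    | drop _ a => rw [hn] at a; simp at a
  intro w v
  obtain ⟨q, hq, hr⟩ := hrun w
  obtain ⟨j, hj⟩ := wrapped_of_run δ k q0 F hr 0 rfl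
  constructor
  · intro h
    obtain rfl := Option.some.inj h
    exact ⟨(q, j), hq, hj⟩
  · rintro ⟨q', hq', h'⟩
    exact congrArg some (steps_det hj (hstuck _ _ _ _ hq) h' (hstuck _ _ _ _ hq'))

end Wrap

section Final
variable {Q C σ N : Type}
    (δ : Q → TapeSym A → Option C → σ × N → Option ((Q × MAct C) × List B))
    (stepR : σ → TapeSym A → σ) (aRoot : σ) (aC : C → σ)
    (stepN : N → TapeSym A → N) (ν0 : N) (q0 : Q)

abbrev Q2 (Q N σ : Type) : Type :=
  (((Q × N) ⊕ (HS N × Q)) × σ) ⊕ (HS σ × ((Q × N) ⊕ (HS N × Q)))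

/-- The final machine first walks to the right end. -/
noncomputable def δ3 : N ⊕ Q2 Q N σ → TapeSym A → Option (C × σ) → Unit →
    Option (((N ⊕ Q2 Q N σ) × MAct (C × σ)) × List B)
  | .inl ν, .rend, c, _ =>
    (δ2 (δ1 δ stepN ν0) stepR aRoot aC (.inl (.inl (q0, ν), aRoot)) .rend c ()).map
      (fun p => ((.inr p.1.1, p.1.2), p.2))
  | .inl ν, .lend, _, _ => some ((.inl (stepN ν .lend), .right), [])
  | .inl ν, .letter a, _, _ => some ((.inl (stepN ν (.letter a)), .right), [])
  | .inr q, s, c, _ =>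
    (δ2 (δ1 δ stepN ν0) stepR aRoot aC q s c ()).map (fun p => ((.inr p.1.1, p.1.2), p.2))

theorem step3 {k : ℕ} {w : List A} {c d : Q2 Q N σ × ℕ × List ((C × σ) × ℕ)} {v : List B}
    (h : Step (δ2 (δ1 δ stepN ν0) stepR aRoot aC) k w (fun _ _ => ()) c v d) :
    Step (δ3 δ stepR aRoot aC stepN ν0 q0) k w (fun _ _ => ()) (.inr c.1, c.2) v (.inr d.1, d.2) := by
  cases h with
  | L hd => exact .L (by simp only [δ3, hd]; rfl)
  | R h0 hd hm => exact .R h0 (by simp only [δ3, hd]; rfl) hm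
  | lift hd => exact .lift (by simp only [δ3, hd]; rfl)
  | drop h0 hk hd => exact .drop h0 hk (by simp only [δ3, hd]; rfl)

theorem step3' {k : ℕ} {w : List A} {d : Q2 Q N σ × ℕ × List ((C × σ) × ℕ)} {v : List B} {ν : N}
    (h : Step (δ2 (δ1 δ stepN ν0) stepR aRoot aC) k w (fun _ _ => ())
      (.inl (.inl (q0, ν), aRoot), w.length + 1, []) v d) :
    Step (δ3 δ stepR aRoot aC stepN ν0 q0) k w (fun _ _ => ()) (.inl ν, w.length + 1, []) v
      (.inr d.1, d.2) := by
  have hr : tapeAt w (w.length + 1) = .rend := PartB.tapeAt_rend.2 le_rfl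
  cases h with
  | L hd => rw [hr] at hd; exact .L (by rw [hr]; simp only [δ3, hd]; rfl)
  | R h0 hd hm => rw [hr] at hd; exact .R h0 (by rw [hr]; simp only [δ3, hd]; rfl) hm
  | drop h0 hk hd => rw [hr] at hd; exact .drop h0 hk (by rw [hr]; simp only [δ3, hd]; rfl)

theorem run3 {k : ℕ} {w : List A} {c d : Q2 Q N σ × ℕ × List ((C × σ) × ℕ)} {v : List B}
    (h : Run (δ2 (δ1 δ stepN ν0) stepR aRoot aC) k w (fun _ _ => ()) c v d) :
    Run (δ3 δ stepR aRoot aC stepN ν0 q0) k w (fun _ _ => ()) (.inr c.1, c.2) v (.inr d.1, d.2) := by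
  induction h with
  | refl => exact .refl _
  | cons s _ ih => exact .cons (step3 δ stepR aRoot aC stepN ν0 q0 s) ih

theorem walk3 {k : ℕ} (w : List A) : ∀ m, m ≤ w.length + 1 →
    Run (δ3 δ stepR aRoot aC stepN ν0 q0) k w (fun _ _ => ()) (.inl ν0, 0, []) []
      (.inl (annN stepN ν0 w m), m, []) := by
  intro m
  induction m with
  | zero => intro _; exact .refl _
  | succ m ih =>
    intro hm
    refine (ih (by omega)).trans (u := []) (Run.one (.R rfl ?_ (by omega)))
    have h3 : ¬ tapeAt w m = .rend := by rw [PartB.tapeAt_rend]; omega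
    simp only [annN]
    revert h3
    cases tapeAt w m <;> simp [δ3]

/-- The combination of all the previous transformations. -/
theorem oracle_computable [Finite Q] [Finite C] [Finite σ] [Finite N]
    (k : ℕ) (f : List A → List B) (qf : Q) (hq : q0 ≠ qf)
    (hrun : ∀ w, Run δ k w (fun m π => (annR stepR aRoot aC w m π, annN stepN ν0 w m))
      (q0, w.length + 1, []) (f w) (qf, w.length + 1, []))
    (hF : ∀ s c e, δ qf s c e = none) : ComputableKMarble f k := by
  refine wrap_computes (δ3 δ stepR aRoot aC stepN ν0 q0) k (.inl ν0)
    {q | ∃ ν L, q = .inr (.inl (.inl (qf, ν), L))} f ?_ ?_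
  · rintro q ⟨ν, L, rfl⟩ s c
    simp [δ3, δ2, δ1, hF]
  · intro w
    have hw : Wf w.length (w.length + 1) ([] : List (C × ℕ)) := ⟨le_rfl, by simp, by simp⟩
    have h1 := run1 δ stepN ν0 (ann := fun m π => annR stepR aRoot aC w m π) (hrun w) hw
    have h2 := run2 _ stepR aRoot aC h1 hw
    refine ⟨_, ⟨annN stepN ν0 w (w.length + 1), annR stepR aRoot aC w (w.length + 1) [], rfl⟩,
      (walk3 δ stepR aRoot aC stepN ν0 q0 w (w.length + 1) le_rfl).trans
      (v := []) ?_⟩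
    simp only [enc] at h2
    have ha : annR stepR aRoot aC w (w.length + 1) [] = aRoot := by
      simp [annR, anPos, anVal, chain]
    rw [ha] at h2 ⊢
    generalize hc : ((Sum.inl (Sum.inl (q0, annN stepN ν0 w (w.length + 1)), aRoot),
      w.length + 1, []) : Q2 Q N σ × ℕ × List ((C × σ) × ℕ)) = c at h2
    generalize f w = v at h2 ⊢
    cases h2 with
    | refl => simp at hc; exact absurd hc hq
    | cons s r =>
      subst hc
      exact .cons (step3' δ stepR aRoot aC stepN ν0 q0 s) (run3 δ stepR aRoot aC stepN ν0 q0 r)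

end Final

end PartD


namespace PartD

variable {A B : Type}

/-- Lists of bounded length. -/
def BL (Y : Type) (K : ℕ) : Type := {l : List Y // l.length ≤ K}

instance finiteBL {Y : Type} [Finite Y] {K : ℕ} : Finite (BL Y K) :=
  (List.finite_length_le Y K).to_subtype

def BL.mk {Y : Type} {K : ℕ} (l : List Y) : BL Y K := ⟨l.take K, by simp⟩

theorem BL.mk_val {Y : Type} {K : ℕ} (l : List Y) (h : l.length ≤ K) :
    (BL.mk l : BL Y K).1 = l := by
  simp [BL.mk, h]

/-- A layered system together with all the bounds. -/
structure LSys (A B X : Type) where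
  upd : A → X → List X
  init : X → List B
  out : List X
  L : X → ℕ
  k : ℕ
  K : ℕ
  Kc : ℕ
  KB : ℕ
  hL : ∀ x, L x ≤ k + 1
  hmono : ∀ a x, ∀ y ∈ upd a x, L y ≤ L x
  hK : ∀ r x, (PartC.W (PartC.sameL upd L) r x).length ≤ K
  hKB : ∀ r x, L x = 0 → (hval upd init r x).length ≤ KB
  hKc : ∀ a x, (upd a x).length ≤ Kc
  hKo : out.length ≤ Kc
  hK1 : 1 ≤ Kc

inductive Reg (X : Type) where
  | root
  | virt (x : X)
  | reg (x : X)

instance finiteReg {X : Type} [Finite X] : Finite (Reg X) := by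
  let g : Reg X → Unit ⊕ (X ⊕ X) := fun r =>
    match r with
    | .root => Sum.inl ()
    | .virt x => Sum.inr (Sum.inl x)
    | .reg x => Sum.inr (Sum.inr x)
  apply Finite.of_injective g
  rintro (_ | x | x) (_ | y | y) h <;> simp [g] at h ⊢ <;> exact h

section
variable {X : Type} (D : LSys A B X)

def LSys.KL : ℕ := (D.out.length + 1) * D.K + 1

abbrev Ix : Type := Fin (D.KL + 1)
abbrev Sb : Type := BL X D.Kc

def ix (n : ℕ) : Ix D := Fin.ofNat _ n

theorem ix_val {n : ℕ} (h : n ≤ D.KL) : (ix D n).1 = n := by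
  simp [ix, Fin.ofNat, Nat.mod_eq_of_lt (Nat.lt_succ_of_le h)]

abbrev Ent : Type := Reg X × Ix D × Sb D

def lay : Reg X → ℕ
  | .root => D.k + 1
  | .virt x => D.L x
  | .reg x => D.L x

def ch (s : TapeSym A) : Reg X → List X
  | .root => D.out
  | .virt x => [x]
  | .reg x => match s with
    | .letter a => D.upd a x
    | _ => []

theorem ch_length (s : TapeSym A) (r : Reg X) : (ch D s r).length ≤ D.Kc := by
  rcases r with _ | x | x
  · exact D.hKo
  · exact D.hK1
  · rcases s with _ | _ | a
    · simp [ch]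
    · simp [ch]
    · exact D.hKc a x

theorem ch_lay (s : TapeSym A) (r : Reg X) : ∀ y ∈ ch D s r, D.L y ≤ lay D r := by
  intro y hy
  rcases r with _ | x | x
  · exact D.hL y
  · simp [ch] at hy; subst hy; exact le_rfl
  · rcases s with _ | _ | a
    · simp [ch] at hy
    · simp [ch] at hy
    · exact D.hmono a x y hy

open Classical in
noncomputable def kids (i l : ℕ) : List X → List (Ent D)
  | [] => []
  | y :: c => if D.L y = l then (.reg y, ix D i, BL.mk c) :: kids i l c else kids i l c

noncomputable def Fa (s : TapeSym A) : ℕ → List (Ent D) → List (Ent D)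
  | _, [] => []
  | i, e :: l => kids D i (lay D e.1) (ch D s e.1) ++ Fa s (i + 1) l

open Classical in
theorem kids_regs (i l : ℕ) (c : List X) :
    (kids D i l c).map Prod.fst = (c.filter (fun y => D.L y = l)).map Reg.reg := by
  induction c with
  | nil => rfl
  | cons y c ih =>
    simp only [kids]
    split_ifs with h <;> simp [h, ih]

open Classical in
theorem Fa_regs (s : TapeSym A) (i : ℕ) (l : List (Ent D)) :
    (Fa D s i l).map Prod.fst = (l.map Prod.fst).flatMap
      (fun r => ((ch D s r).filter (fun y => D.L y = lay D r)).map Reg.reg) := by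
  induction l generalizing i with
  | nil => rfl
  | cons e l ih => simp [Fa, kids_regs, ih]

theorem kids_mem (i l : ℕ) (c1 : List X) (y : X) (c : List X) (hy : D.L y = l) :
    ((.reg y, ix D i, BL.mk c) : Ent D) ∈ kids D i l (c1 ++ y :: c) := by
  induction c1 with
  | nil => simp [kids, hy]
  | cons z c1 ih =>
    simp only [List.cons_append, kids]
    split_ifs
    · exact List.mem_cons_of_mem _ ih
    · exact ih

theorem Fa_mem (s : TapeSym A) (i : ℕ) (l : List (Ent D)) (j : ℕ) (e : Ent D) (he : l[j]? = some e)
    (c1 : List X) (y : X) (c : List X) (hc : ch D s e.1 = c1 ++ y :: c) (hy : D.L y = lay D e.1) :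
    ((.reg y, ix D (i + j), BL.mk c) : Ent D) ∈ Fa D s i l := by
  induction l generalizing i j with
  | nil => simp at he
  | cons e' l ih =>
    simp only [Fa, List.mem_append]
    cases j with
    | zero =>
      simp at he; subst he
      left
      rw [hc]
      exact kids_mem D i _ c1 y c hy
    | succ j =>
      right
      have := ih (i + 1) j (by simpa using he)
      rwa [show i + 1 + j = i + (j + 1) by omega] at this

/-- Lists of entries which may occur. -/
def Good (l : List (Ent D)) : Prop :=
  l.map Prod.fst = [.root] ∨ (∃ y, l.map Prod.fst = [.virt y]) ∨
  ∃ (c : List X) (r : List A), c.length ≤ D.out.length + 1 ∧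
    l.map Prod.fst = (c.flatMap (PartC.W (PartC.sameL D.upd D.L) r)).map Reg.reg

theorem Good.length {l : List (Ent D)} (h : Good D l) : l.length ≤ D.KL := by
  unfold LSys.KL
  rw [← List.length_map (f := Prod.fst)]
  rcases h with h | ⟨y, h⟩ | ⟨c, r, hc, h⟩
  · rw [h]; simp
  · rw [h]; simp
  · rw [h, List.length_map]
    have : (c.flatMap (PartC.W (PartC.sameL D.upd D.L) r)).length ≤ c.length * D.K := by
      clear hc h
      induction c with
      | nil => simp
      | cons y c ih =>
        have := D.hK r y
        simp only [List.flatMap_cons, List.length_append, List.length_cons]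
        nlinarith
    have h2 := Nat.mul_le_mul_right D.K hc
    omega

theorem Good.step {l : List (Ent D)} (h : Good D l) (s : TapeSym A) : Good D (Fa D s 0 l) := by
  classical
  right; right
  rw [Fa_regs]
  rcases h with h | ⟨y, h⟩ | ⟨c, r, hc, h⟩
  · refine ⟨D.out.filter (fun y => D.L y = D.k + 1), [], ?_, ?_⟩
    · exact (List.length_filter_le _ _).trans (by omega)
    · rw [h]
      have : PartC.W (PartC.sameL D.upd D.L) [] = fun x => [x] := rfl
      simp [ch, lay, this]
      all_goals congr!
  · refine ⟨[y], [], by simp, ?_⟩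
    rw [h]
    have : PartC.W (PartC.sameL D.upd D.L) [] = fun x => [x] := rfl
    simp [ch, lay, this]
  · rcases s with _ | _ | a
    · refine ⟨[], [], by simp, ?_⟩
      rw [h]; simp [ch, List.flatMap_map]
    · refine ⟨[], [], by simp, ?_⟩
      rw [h]; simp [ch, List.flatMap_map]
    · refine ⟨c, r ++ [a], hc, ?_⟩
      have h1 : PartC.W (PartC.sameL D.upd D.L) (r ++ [a]) = fun x =>
          (PartC.W (PartC.sameL D.upd D.L) r x).flatMap (PartC.sameL D.upd D.L a) := by
        funext x
        rw [PartC.W_append]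
        congr 1
        funext y
        simp [PartC.W]
      rw [h, h1, List.flatMap_map, ← List.flatMap_assoc, List.map_flatMap]
      rfl

abbrev SR : Type := {l : List (Ent D) // Good D l}

instance finiteSR [Finite X] : Finite (SR D) := by
  have : {l : List (Ent D) | Good D l}.Finite :=
    (List.finite_length_le (Ent D) D.KL).subset (fun l h => Good.length D h)
  exact this.to_subtype

noncomputable def stepR (l : SR D) (s : TapeSym A) : SR D := ⟨Fa D s 0 l.1, l.2.step D s⟩

def aRoot : SR D := ⟨[(.root, ix D 0, BL.mk [])], Or.inl rfl⟩

/-- Colours: index and remaining siblings of the interrupted node, and the visited register. -/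
abbrev Col : Type := Ix D × Sb D × X

def aC (c : Col D) : SR D := ⟨[(.virt c.2.2, ix D 0, BL.mk [])], Or.inr (Or.inl ⟨c.2.2, rfl⟩)⟩

abbrev NN : Type := X → BL B D.KB

def stepN (ν : NN D) : TapeSym A → NN D
  | .lend => fun x => BL.mk (D.init x)
  | .rend => ν
  | .letter a => fun x => BL.mk ((D.upd a x).flatMap (fun y => (ν y).1))

def ν0 : NN D := fun _ => BL.mk []

/-- Value of a register at a position. -/
def V (w : List A) (m : ℕ) (x : X) : List B := hval D.upd D.init (w.take m).reverse x

theorem V_zero (w : List A) (x : X) : V D w 0 x = D.init x := by simp [V, hval]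

theorem V_succ (w : List A) (m : ℕ) (h : m < w.length) (x : X) :
    V D w (m + 1) x = (D.upd w[m] x).flatMap (V D w m) := by
  unfold V
  rw [List.take_succ_eq_append_getElem h, List.reverse_append]
  rfl

theorem annN_val (w : List A) : ∀ m, m ≤ w.length → ∀ x, D.L x = 0 →
    (annN (stepN D) (ν0 D) w (m + 1) x).1 = V D w m x := by
  intro m
  induction m with
  | zero =>
    intro _ x hx
    have h0 : tapeAt w 0 = .lend := PartB.tapeAt_lend.2 rfl
    have := D.hKB [] x hx
    rw [V_zero]
    simp only [annN, h0, stepN]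
    exact BL.mk_val _ this
  | succ m ih =>
    intro hm x hx
    have h0 := PartB.tapeAt_letter (w := w) (m := m) (by omega)
    have hb : (V D w (m + 1) x).length ≤ D.KB := D.hKB _ x hx
    rw [annN, h0]
    simp only [stepN]
    have : (D.upd w[m] x).flatMap (fun y => (annN (stepN D) (ν0 D) w (m + 1) y).1) =
        V D w (m + 1) x := by
      rw [V_succ D w m (by omega)]
      apply List.flatMap_congr
      intro y hy
      exact ih (by omega) y (by have := D.hmono _ _ y hy; omega)
    rw [this, BL.mk_val _ hb]

inductive Ctl where
  | enter (j : Ix D)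
  | proc (j : Ix D) (c : Sb D)
  | fin1
  | fin

instance finiteCtl [Finite X] : Finite (Ctl D) := by
  let g : Ctl D → Ix D ⊕ ((Ix D × Sb D) ⊕ (Unit ⊕ Unit)) := fun r =>
    match r with
    | .enter j => Sum.inl j
    | .proc j c => Sum.inr (Sum.inl (j, c))
    | .fin1 => Sum.inr (Sum.inr (Sum.inl ()))
    | .fin => Sum.inr (Sum.inr (Sum.inr ()))
  apply Finite.of_injective g
  rintro (_ | _ | _ | _) (_ | _ | _ | _) h <;> simp [g] at h ⊢ <;> exact h

def finish (s : TapeSym A) (c : Option (Col D)) (e : Ent D) :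
    (Ctl D × MAct (Col D)) :=
  match c with
  | some c => (.proc c.1 c.2.1, .lift)
  | none => match s with
    | .rend => (.fin1, .left)
    | _ => (.proc e.2.1 e.2.2, .right)

open Classical in
noncomputable def actR (s : TapeSym A) (fi : Ctl D × MAct (Col D)) (l : SR D) (ν : NN D) (j : Ix D)
    (e : Ent D) : List X → (Ctl D × MAct (Col D)) × List B
  | [] => (fi, [])
  | y :: c =>
    if D.L y = 0 then ((actR s fi l ν j e c).1, (ν y).1 ++ (actR s fi l ν j e c).2)
    else if D.L y = lay D e.1 then
      ((.enter (ix D (Classical.epsilon fun n : ℕ =>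
        (stepR D l s).1[n]? = some ((.reg y, j, BL.mk c) : Ent D))), .left), [])
    else ((.proc (ix D 0) (BL.mk [y]), .drop (j, BL.mk c, y)), [])

noncomputable def δ0 : Ctl D → TapeSym A → Option (Col D) → SR D × NN D →
    Option ((Ctl D × MAct (Col D)) × List B)
  | .fin, _, _, _ => none
  | .fin1, _, _, _ => some ((.fin, .right), [])
  | .enter j, .lend, _, (l, _) =>
    match l.1[j.1]? with
    | some (.reg x, i, c) => some ((.proc i c, .right), D.init x)
    | _ => none
  | .enter j, s, c, (l, ν) =>
    (l.1[j.1]?).map fun e => actR D s (finish D s c e) l ν j e (ch D s e.1)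
  | .proc j cs, s, c, (l, ν) =>
    (l.1[j.1]?).map fun e => actR D s (finish D s c e) l ν j e cs.1

noncomputable abbrev aR (w : List A) (m : ℕ) (π : List (Col D × ℕ)) : SR D :=
  annR (stepR D) (aRoot D) (aC D) w m π

abbrev RunD (w : List A) : Ctl D × ℕ × List (Col D × ℕ) → List B →
    Ctl D × ℕ × List (Col D × ℕ) → Prop :=
  Run (δ0 D) D.k w (fun m π => (aR D w m π, annN (stepN D) (ν0 D) w m))

def VisitAt (w : List A) (m : ℕ) : Prop :=
  ∀ (π : List (Col D × ℕ)) (j : Ix D) (x : X) (i : Ix D) (c : Sb D),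
    Wf w.length m π → m < anPos w π → (aR D w m π).1[j.1]? = some (.reg x, i, c) →
    1 ≤ D.L x → π.length + D.L x ≤ D.k + 1 →
    RunD D w (.enter j, m, π) (V D w m x) (.proc i c, m + 1, π)

/-- Visiting a child of the same layer. -/
theorem same_run {w : List A} {m : ℕ} (hV : VisitAt D w m) {π : List (Col D × ℕ)}
    (hw : Wf w.length (m + 1) π) {j : Ix D} {e : Ent D}
    (he : (aR D w (m + 1) π).1[j.1]? = some e) {c1 : List X} {y : X} {c : List X}
    (hc : ch D (tapeAt w (m + 1)) e.1 = c1 ++ y :: c) (hy : D.L y = lay D e.1) (hy0 : D.L y ≠ 0)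
    (hk : π.length + lay D e.1 ≤ D.k + 1) {q : Ctl D} {u : List B} {fi : Ctl D × MAct (Col D)}
    {ν : NN D}
    (hq : δ0 D q (tapeAt w (m + 1)) (marbleAt (m + 1) π)
      (aR D w (m + 1) π, annN (stepN D) (ν0 D) w (m + 1)) =
      some ((actR D (tapeAt w (m + 1)) fi (aR D w (m + 1) π) ν j e (y :: c)).1,
        u ++ (actR D (tapeAt w (m + 1)) fi (aR D w (m + 1) π) ν j e (y :: c)).2)) :
    RunD D w (q, m + 1, π) (u ++ V D w m y) (.proc j (BL.mk c), m + 1, π) := by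
  have hp := hw.anPos_le
  have hst := annR_step (stepR D) (aRoot D) (aC D) w m π (by omega)
  simp only [actR, if_neg hy0, if_pos hy, List.append_nil] at hq
  have hmem := Fa_mem D (tapeAt w (m + 1)) 0 (aR D w (m + 1) π).1 j.1 e he c1 y c hc hy
  have hj : ix D (0 + j.1) = j := by
    apply Fin.ext; rw [zero_add, ix_val]; omega
  rw [hj] at hmem
  have hex : ∃ n : ℕ, (stepR D (aR D w (m + 1) π) (tapeAt w (m + 1))).1[n]? =
      some ((.reg y, j, BL.mk c) : Ent D) := List.mem_iff_getElem?.1 hmem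
  have hsp := Classical.epsilon_spec hex
  set n := Classical.epsilon fun n : ℕ =>
        (stepR D (aR D w (m + 1) π) (tapeAt w (m + 1))).1[n]? = some ((.reg y, j, BL.mk c) : Ent D)
    with hn
  have hnl : n ≤ D.KL := by
    have h1 := (List.getElem?_eq_some_iff.1 hsp).1
    have h2 := Good.length D (stepR D (aR D w (m + 1) π) (tapeAt w (m + 1))).2
    omega
  refine Run.cons (Step.L hq) ?_
  refine hV π (ix D n) y j (BL.mk c) ⟨by have := hw.1; omega,
    fun x hx => ⟨by have := (hw.2.1 x hx).1; omega, (hw.2.1 x hx).2⟩, hw.2.2⟩ (by omega) ?_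
    (by omega) (by omega)
  rw [ix_val D hnl]
  have hst' : aR D w m π = stepR D (aR D w (m + 1) π) (tapeAt w (m + 1)) := hst.symm
  rw [hst']
  exact hsp

/-- Processing a list of children. -/
theorem proc_run {w : List A} {m : ℕ} (hm : m ≤ w.length) (hV : VisitAt D w m)
    {π : List (Col D × ℕ)}
    (hw : Wf w.length (m + 1) π) {j : Ix D} {e : Ent D}
    (he : (aR D w (m + 1) π).1[j.1]? = some e)
    (hk : π.length + lay D e.1 ≤ D.k + 1)
    (hdrop : marbleAt (m + 1) π = none)
    {ce : Ctl D × ℕ × List (Col D × ℕ)}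
    (hfin : ∀ q u, δ0 D q (tapeAt w (m + 1)) (marbleAt (m + 1) π)
      (aR D w (m + 1) π, annN (stepN D) (ν0 D) w (m + 1)) =
        some (finish D (tapeAt w (m + 1)) (marbleAt (m + 1) π) e, u) →
      RunD D w (q, m + 1, π) u ce) :
    ∀ (c c1 : List X), ch D (tapeAt w (m + 1)) e.1 = c1 ++ c → ∀ (q : Ctl D) (u : List B),
    δ0 D q (tapeAt w (m + 1)) (marbleAt (m + 1) π)
      (aR D w (m + 1) π, annN (stepN D) (ν0 D) w (m + 1)) =
      some ((actR D (tapeAt w (m + 1)) (finish D (tapeAt w (m + 1)) (marbleAt (m + 1) π) e)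
          (aR D w (m + 1) π) (annN (stepN D) (ν0 D) w (m + 1)) j e c).1,
        u ++ (actR D (tapeAt w (m + 1)) (finish D (tapeAt w (m + 1)) (marbleAt (m + 1) π) e)
          (aR D w (m + 1) π) (annN (stepN D) (ν0 D) w (m + 1)) j e c).2) →
    RunD D w (q, m + 1, π) (u ++ c.flatMap (V D w m)) ce := by
  intro c
  induction c with
  | nil =>
    intro c1 hc q u hq
    simp only [actR, List.append_nil] at hq
    simpa using hfin q u hq
  | cons y c ih =>
    intro c1 hc q u hq
    have hcK : (BL.mk c : Sb D).1 = c := by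
      apply BL.mk_val
      have := ch_length D (tapeAt w (m + 1)) e.1
      rw [hc] at this
      simp at this
      omega
    have hc' : ch D (tapeAt w (m + 1)) e.1 = (c1 ++ [y]) ++ c := by simp [hc]
    have hnext : RunD D w (.proc j (BL.mk c), m + 1, π) (c.flatMap (V D w m)) ce := by
      refine ih _ hc' _ [] ?_
      simp only [δ0, he, hcK, Option.map_some, List.nil_append]
    by_cases hy0 : D.L y = 0
    · have hν := annN_val D w m hm y hy0
      simp only [actR, if_pos hy0] at hq
      rw [hν, ← List.append_assoc] at hq
      have := ih _ hc' q _ hq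
      simpa using this
    by_cases hy : D.L y = lay D e.1
    · have := same_run D hV hw he hc hy hy0 hk hq
      simpa using this.trans hnext
    · have hle := ch_lay D (tapeAt w (m + 1)) e.1 y (by simp [hc])
      simp only [actR, if_neg hy0, if_neg hy, List.append_nil] at hq
      rw [hdrop] at hq
      have hs := Step.drop (δ := δ0 D) (k := D.k) (w := w)
        (ann := fun m π => (aR D w m π, annN (stepN D) (ν0 D) w m)) hdrop (by omega) hq
      rw [List.flatMap_cons]
      refine Run.cons hs ?_
      refine Run.trans ?_ hnext
      have hw' : Wf w.length (m + 1) (((j, BL.mk c, y), m + 1) :: π : List (Col D × ℕ)) :=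
        hw.step hs
      have htop : aR D w (m + 1) (((j, BL.mk c, y), m + 1) :: π) = aC D (j, BL.mk c, y) :=
        annR_top _ _ _ _ _ _ _
      have hmk : (BL.mk [y] : Sb D).1 = [y] := BL.mk_val _ D.hK1
      have h0 : (ix D 0).1 = 0 := ix_val D (Nat.zero_le _)
      have hma : marbleAt (m + 1) (((j, BL.mk c, y), m + 1) :: π : List (Col D × ℕ)) =
        some (j, BL.mk c, y) := by simp [marbleAt]
      have he' : (aR D w (m + 1) (((j, BL.mk c, y), m + 1) :: π)).1[(ix D 0).1]? =
          some (.virt y, ix D 0, BL.mk []) := by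
        rw [htop, h0]; rfl
      have hr := same_run D hV hw' he' (c1 := []) (y := y) (c := []) rfl rfl hy0
        (by simp only [lay, List.length_cons]; omega) (q := .proc (ix D 0) (BL.mk [y])) (u := [])
        (fi := finish D (tapeAt w (m + 1)) (some (j, BL.mk c, y)) (.virt y, ix D 0, BL.mk []))
        (ν := annN (stepN D) (ν0 D) w (m + 1)) ?_
      · have hmk0 : (BL.mk [] : Sb D).1 = [] := BL.mk_val _ (by simp)
        rw [← List.append_nil (V D w m y)]
        refine Run.trans hr (Run.one (Step.lift ?_))
        simp only [δ0]
        rw [he', hmk0]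
        rfl
      · simp only [δ0]
        rw [he', hmk, hma]
        rfl

theorem visit (w : List A) : ∀ m, m ≤ w.length → VisitAt D w m := by
  intro m
  induction m with
  | zero =>
    intro _ π j x i c hw hp he hx hk
    have h0 : tapeAt w 0 = .lend := PartB.tapeAt_lend.2 rfl
    refine Run.one (Step.R (marbleAt_ne w _ _ (by omega)) ?_ (by omega))
    rw [h0, V_zero]
    simp only [δ0]
    rw [he]
  | succ m ih =>
    intro hm π j x i c hw hp he hx hk
    have h0 := PartB.tapeAt_letter (w := w) (m := m) (by omega)
    have hno : marbleAt (m + 1) π = none := marbleAt_ne w _ _ (by omega)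
    rw [V_succ D w m (by omega)]
    have := proc_run D (by omega) (ih (by omega)) hw he hk hno
      (ce := (.proc i c, m + 1 + 1, π)) ?_ (D.upd w[m] x) [] (by rw [h0]; rfl) (.enter j) [] ?_
    · simpa using this
    · intro q u hq
      refine Run.one (Step.R hno ?_ hm)
      rw [hno, h0] at hq
      rw [h0]
      exact hq
    · rw [h0]
      simp only [δ0]
      rw [he]
      rfl

theorem main_run (w : List A) :
    RunD D w (.proc (ix D 0) (BL.mk D.out), w.length + 1, []) (D.out.flatMap (V D w w.length))
      (.fin, w.length + 1, []) := by
  have hr : tapeAt w (w.length + 1) = .rend := PartB.tapeAt_rend.2 le_rfl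
  have hw : Wf w.length (w.length + 1) ([] : List (Col D × ℕ)) := ⟨le_rfl, by simp, by simp⟩
  have htop : aR D w (w.length + 1) [] = aRoot D := by
    simp [annR, anPos, anVal, chain]
  have h0 : (ix D 0).1 = 0 := ix_val D (Nat.zero_le _)
  have hmk : (BL.mk D.out : Sb D).1 = D.out := BL.mk_val _ D.hKo
  have he : (aR D w (w.length + 1) []).1[(ix D 0).1]? = some (.root, ix D 0, BL.mk []) := by
    rw [htop, h0]; rfl
  have := proc_run D le_rfl (visit D w w.length le_rfl) hw he
    (by simp [lay]) rfl (ce := (.fin, w.length + 1, [])) ?_ D.out [] rfl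
    (.proc (ix D 0) (BL.mk D.out)) [] ?_
  · simpa using this
  · intro q u hq
    rw [← List.append_nil u]
    have hq' : finish D (tapeAt w (w.length + 1)) (marbleAt (w.length + 1) [])
      (.root, ix D 0, BL.mk []) = (.fin1, .left) := by rw [hr]; rfl
    rw [hq'] at hq
    exact Run.cons (Step.L hq) (Run.one (Step.R rfl rfl le_rfl))
  · simp only [δ0]
    rw [he, hmk]
    rfl

theorem LSys.computable [Finite X] [Finite B] : 
    ComputableKMarble (fun w => D.out.flatMap (hval D.upd D.init w.reverse)) D.k := by
  refine oracle_computable (δ0 D) (stepR D) (aRoot D) (aC D) (stepN D) (ν0 D)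
    (.proc (ix D 0) (BL.mk D.out)) D.k _ .fin (by simp) ?_ (fun _ _ _ => rfl)
  intro w
  have := main_run D w
  have hV : V D w w.length = hval D.upd D.init w.reverse := by
    funext x; simp [V]
  rw [hV] at this
  exact this

end

theorem computable_of_growth {X : Type} [Finite A] [Finite B] [Finite X] (upd : A → X → List X)
    (init : X → List B) (out : List X) (f : List A → List B)
    (hf : ∀ w, f w = out.flatMap (hval upd init w.reverse)) (k : ℕ)
    (hg : ∃ C : ℕ, ∀ w, (f w).length ≤ C * w.length ^ (k + 1) + C) : ComputableKMarble f k := by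
  obtain ⟨upd', out', L, hL, hmono, hf', ⟨K, hK⟩, ⟨KB, hKB⟩⟩ :=
    PartC.layered upd init out f hf k hg
  obtain ⟨M, hM⟩ := PartA.exists_bound (fun p : A × X => (upd' p.1 p.2).length)
  have := LSys.computable (⟨upd', init, out', L, k, K, M + out'.length + 1, KB, hL, hmono, hK, hKB,
    fun a x => by have := hM (a, x); simp only at this; omega, by omega, by omega⟩ : LSys A B X)
  have hfe : f = fun w => out'.flatMap (hval upd' init w.reverse) := funext hf'
  rw [hfe]
  exact this

end PartD


theorem stmt4 {A B : Type} [Fintype A] [Fintype B] (f : List A → List B)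
    (T : MarbleT A B) (hT : T.Computes (fun w => some (f w))) (k : ℕ) :
    ComputableKMarble f k ↔ (∃ C : ℕ, ∀ w, (f w).length ≤ C * w.length ^ (k + 1) + C) := by
  refine ⟨PartA.growth f k, fun hg => ?_⟩
  obtain ⟨X, hX, upd, init, out, hf⟩ := PartB.toSys T f hT
  exact PartD.computable_of_growth upd init out f hf k hg
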